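/- Fix a positive odd integer h, an integer r, and a real ε > 0. Then there is a constant C = C(ε, r, h) such that for all x ≥ 3 and all real A, B with A, B ≥ x^ε and A·B ≥ x·(log x)^8, one has | (1/#𝒞(A,B)) · Σ_{E(a,b) ∈ 𝒞(A,B)} Π^𝔟_{E(a,b),r,h}(x) − Σ_{p odd prime, p ≤ x} Π^𝔟(p)/(p(p−1)) | ≤ C · x/(log x)^2. -/

import Mathlib

noncomputable section

/-- Number of affine points of `y² = x³ + ax + b` over `ZMod p`. -/
def affPts (p : ℕ) (a b : ZMod p) : ℕ :=
  Nat.card {xy : ZMod p × ZMod p // xy.2 ^ 2 = xy.1 ^ 3 + a * xy.1 + b}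

/-- Trace of Frobenius `a_p = p + 1 - #E(𝔽_p)`, the projective count being
the affine count plus the point at infinity. -/
def apE (p : ℕ) (a b : ZMod p) : ℤ := (p : ℤ) + 1 - ((affPts p a b : ℤ) + 1)

/-- `Δ(r,h)`: squarefree integers congruent to `r` modulo `h`. -/
def DeltaSet (r : ℤ) (h : ℕ) : Set ℤ := {n : ℤ | Squarefree n ∧ n ≡ r [ZMOD (h : ℤ)]}

/-- `Π^𝔟_{E(a,b),r,h}(x)`: the number of primes `2 < p ≤ x` of good reduction such that
`a_p² - 4p` is squarefree and congruent to `r` mod `h`. -/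
def PiQb (r : ℤ) (h : ℕ) (a b : ℤ) (x : ℝ) : ℕ :=
  Nat.card {p : ℕ // p.Prime ∧ 2 < p ∧ (p : ℝ) ≤ x ∧ ¬ ((p : ℤ) ∣ (4 * a ^ 3 + 27 * b ^ 2)) ∧
    (apE p (a : ZMod p) (b : ZMod p)) ^ 2 - 4 * (p : ℤ) ∈ DeltaSet r h}

/-- The family `𝒞(A,B)` of integral curves `E(a,b)` with `|a| ≤ A`, `|b| ≤ B`,
`4a³ + 27b² ≠ 0`. -/
def curveBox (A B : ℝ) : Finset (ℤ × ℤ) :=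
  ((Finset.Icc (-⌊A⌋) ⌊A⌋) ×ˢ (Finset.Icc (-⌊B⌋) ⌊B⌋)).filter
    fun ab => 4 * ab.1 ^ 3 + 27 * ab.2 ^ 2 ≠ 0

/-- `Π^𝔟(p)`: the number of pairs `(a,b) ∈ 𝔽_p²` with `4a³+27b² ≠ 0` such that
`a_p(E(a,b))² - 4p` is squarefree and congruent to `r` mod `h`. -/
def PiFp (r : ℤ) (h : ℕ) (p : ℕ) : ℕ :=
  Nat.card {ab : ZMod p × ZMod p // 4 * ab.1 ^ 3 + 27 * ab.2 ^ 2 ≠ 0 ∧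
    (apE p ab.1 ab.2) ^ 2 - 4 * (p : ℤ) ∈ DeltaSet r h}

open Finset

/-- The additive character `θ ↦ exp (2πiθ)`. -/
def expi (θ : ℝ) : ℂ := Complex.exp (2 * Real.pi * θ * Complex.I)

theorem expi_add (s t : ℝ) : expi (s + t) = expi s * expi t := by
  unfold expi; rw [← Complex.exp_add]; push_cast; ring_nf

theorem norm_expi (t : ℝ) : ‖expi t‖ = 1 := by
  unfold expi
  have : (2 * Real.pi * t * Complex.I : ℂ) = ((2 * Real.pi * t : ℝ) : ℂ) * Complex.I := by
    push_cast; ring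
  rw [this, Complex.norm_exp_ofReal_mul_I]

theorem conj_expi (t : ℝ) : (starRingEnd ℂ) (expi t) = expi (-t) := by
  unfold expi
  rw [← Complex.exp_conj]
  simp [Complex.conj_ofReal, Complex.conj_ofNat]

theorem expi_int (n : ℤ) : expi n = 1 := by
  unfold expi
  rw [Complex.exp_eq_one_iff]
  exact ⟨n, by push_cast; ring⟩

theorem expi_nat_mul (k : ℕ) (t : ℝ) : expi (k * t) = expi t ^ k := by
  unfold expi
  rw [← Complex.exp_nat_mul]; push_cast; ring_nf

theorem expi_fract (t : ℝ) (k : ℕ) : expi (k * t) = expi (k * Int.fract t) := by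
  have : (k : ℝ) * t = k * Int.fract t + ((k * ⌊t⌋ : ℤ) : ℝ) := by
    push_cast; rw [← mul_add, Int.fract_add_floor]
  rw [this, expi_add, expi_int, mul_one]

/-- The geometric sum `∑_{k<K} e(kβ)`. -/
def dirichletSum (K : ℕ) (β : ℝ) : ℂ := ∑ k ∈ range K, expi (k * β)

theorem norm_dirichletSum_le (K : ℕ) (β : ℝ) : ‖dirichletSum K β‖ ≤ K := by
  unfold dirichletSum
  refine (norm_sum_le _ _).trans ?_
  simp [norm_expi]

theorem norm_expi_sub_one (β : ℝ) : ‖expi β - 1‖ = 2 * |Real.sin (Real.pi * β)| := by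
  have : (expi β - 1) = expi (β / 2) * (expi (β / 2) - expi (-(β / 2))) := by
    rw [mul_sub, ← expi_add, ← expi_add]; ring_nf
    rw [show expi 0 = 1 by simpa using expi_int 0]; ring
  rw [this, norm_mul, norm_expi, one_mul]
  have h2 : expi (β / 2) - expi (-(β / 2)) = ((2 * Real.sin (Real.pi * β) : ℝ) : ℂ) * Complex.I := by
    unfold expi
    push_cast
    rw [Complex.sin]
    have e1 : (2 * Real.pi * (β / 2) * Complex.I : ℂ) = Real.pi * β * Complex.I := by ring
    have e2 : (2 * Real.pi * (-(β / 2)) * Complex.I : ℂ) = -(Real.pi * β) * Complex.I := by ring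
    rw [e1, e2]
    linear_combination (Complex.exp (Real.pi * β * Complex.I) -
      Complex.exp (-(Real.pi * β) * Complex.I)) * Complex.I_sq
  rw [h2, norm_mul, Complex.norm_I, mul_one, Complex.norm_real, Real.norm_eq_abs, abs_mul]
  norm_num

theorem sin_pi_mul_ge {β : ℝ} (h0 : 0 ≤ β) (h1 : β ≤ 1) :
    2 * min β (1 - β) ≤ Real.sin (Real.pi * β) := by
  have key : ∀ t : ℝ, 0 ≤ t → t ≤ 1 / 2 → 2 * t ≤ Real.sin (Real.pi * t) := by
    intro t ht ht'
    have := Real.mul_le_sin (x := Real.pi * t) (by positivity) (by nlinarith [Real.pi_pos])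
    have e : 2 / Real.pi * (Real.pi * t) = 2 * t := by field_simp
    linarith
  rcases le_total β (1 / 2) with h | h
  · rw [min_eq_left (by linarith)]; exact key β h0 h
  · rw [min_eq_right (by linarith)]
    have := key (1 - β) (by linarith) (by linarith)
    rwa [show Real.pi * (1 - β) = Real.pi - Real.pi * β by ring, Real.sin_pi_sub] at this

theorem norm_sq_dirichletSum_le {β : ℝ} (K : ℕ) (h0 : 0 < β) (h1 : β < 1) :
    ‖dirichletSum K β‖ ^ 2 ≤ 1 / (4 * β ^ 2) + 1 / (4 * (1 - β) ^ 2) := by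
  have hm : 0 < min β (1 - β) := lt_min h0 (by linarith)
  have hs := sin_pi_mul_ge h0.le h1.le
  have hne : expi β - 1 ≠ 0 := by
    intro h
    have := norm_expi_sub_one β
    rw [h, norm_zero] at this
    have h3 := le_abs_self (Real.sin (Real.pi * β))
    linarith
  have hD : dirichletSum K β = (expi β ^ K - 1) / (expi β - 1) := by
    unfold dirichletSum
    rw [← geom_sum_eq (by intro h; apply hne; rw [h, sub_self])]
    exact sum_congr rfl fun k _ => expi_nat_mul k β
  have hb : ‖dirichletSum K β‖ ≤ 1 / (2 * min β (1 - β)) := by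
    rw [hD, norm_div, norm_expi_sub_one]
    have h4 : ‖expi β ^ K - 1‖ ≤ 2 := by
      refine (norm_sub_le _ _).trans ?_
      rw [norm_pow, norm_expi]; norm_num
    have h3 := le_abs_self (Real.sin (Real.pi * β))
    rw [div_le_div_iff₀ (by linarith) (by linarith)]
    nlinarith [norm_nonneg (expi β ^ K - 1)]
  calc ‖dirichletSum K β‖ ^ 2 ≤ (1 / (2 * min β (1 - β))) ^ 2 := by
        gcongr
    _ ≤ _ := by
        have a1 : 0 ≤ 1 / (4 * β ^ 2) := by positivity
        have a2 : 0 ≤ 1 / (4 * (1 - β) ^ 2) := by positivity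
        rcases min_choice β (1 - β) with h | h <;> rw [h, div_pow, mul_pow] <;> norm_num at * <;>
          linarith

theorem sum_range_inv_sq_le_two (n : ℕ) : ∑ i ∈ range n, ((i : ℝ) ^ 2)⁻¹ ≤ 2 := by
  have := sum_Ioo_inv_sq_le (α := ℝ) 0 n
  have e : ∑ i ∈ Ioo 0 n, ((i : ℝ) ^ 2)⁻¹ = ∑ i ∈ range n, ((i : ℝ) ^ 2)⁻¹ := by
    refine sum_subset (fun i hi => by simp at hi ⊢; omega) fun i hi hi' => ?_
    have : i = 0 := by simp at hi hi'; omega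
    simp [this]
  rw [← e]; simpa using this

theorem sum_norm_sq_dirichletSum_le {ι : Type*} (R : Finset ι) (β : ι → ℝ) (K N : ℕ) (hN : 0 < N)
    (hβ : ∀ s ∈ R, ∀ t ∈ R, s ≠ t → 1 / (N : ℝ) ≤ |Int.fract (β s) - Int.fract (β t)|) :
    ∑ s ∈ R, ‖dirichletSum K (β s)‖ ^ 2 ≤ 2 * (K : ℝ) ^ 2 + (N : ℝ) ^ 2 := by
  have hN' : (0 : ℝ) < N := by exact_mod_cast hN
  set G : ℕ → ℝ := fun j => (if j = 0 then (K : ℝ) ^ 2 else 0) +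
    (if j = N - 1 then (K : ℝ) ^ 2 else 0) + (N : ℝ) ^ 2 / 4 * ((j : ℝ) ^ 2)⁻¹ +
    (N : ℝ) ^ 2 / 4 * (((N - 1 - j : ℕ) : ℝ) ^ 2)⁻¹ with hG
  have hG0 : ∀ j, 0 ≤ G j := by
    intro j; simp only [hG]; positivity
  set J : ι → ℕ := fun s => ⌊Int.fract (β s) * N⌋₊ with hJ
  have hf0 : ∀ s, 0 ≤ Int.fract (β s) * N := fun s => mul_nonneg (Int.fract_nonneg _) hN'.le
  have hJlt : ∀ s, J s < N := by
    intro s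
    rw [hJ, Nat.floor_lt (hf0 s)]
    have := Int.fract_lt_one (β s)
    nlinarith
  have hJle : ∀ s, (J s : ℝ) ≤ Int.fract (β s) * N := fun s => Nat.floor_le (hf0 s)
  have hJlt' : ∀ s, Int.fract (β s) * N < J s + 1 := fun s => Nat.lt_floor_add_one _
  have hinj : Set.InjOn J R := by
    intro s hs t ht hst
    by_contra hne
    have h1 := hβ s hs t ht hne
    have a1 := hJle s
    have a2 := hJle t
    have b1 := hJlt' s
    have b2 := hJlt' t
    rw [hst] at a1 b1
    rw [div_le_iff₀ hN'] at h1
    have : |Int.fract (β s) - Int.fract (β t)| * N < 1 := by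
      rw [← abs_of_pos hN', ← abs_mul, abs_lt, sub_mul]
      constructor <;> linarith
    linarith
  have hle : ∀ s, ‖dirichletSum K (β s)‖ ^ 2 ≤ G (J s) := by
    intro s
    have hK : ‖dirichletSum K (β s)‖ ^ 2 ≤ (K : ℝ) ^ 2 := by
      gcongr; exact norm_dirichletSum_le K _
    have p1 : 0 ≤ (N : ℝ) ^ 2 / 4 * ((J s : ℝ) ^ 2)⁻¹ := by positivity
    have p2 : 0 ≤ (N : ℝ) ^ 2 / 4 * (((N - 1 - J s : ℕ) : ℝ) ^ 2)⁻¹ := by positivity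
    by_cases h0 : J s = 0
    · have : (0 : ℝ) ≤ if J s = N - 1 then (K : ℝ) ^ 2 else 0 := by positivity
      simp only [hG]; rw [if_pos h0]; linarith
    by_cases h1 : J s = N - 1
    · have : (0 : ℝ) ≤ if J s = 0 then (K : ℝ) ^ 2 else 0 := by positivity
      simp only [hG]; rw [if_pos h1]; linarith
    simp only [hG]; rw [if_neg h0, if_neg h1]
    have hlt := hJlt s
    have c1 : (1 : ℝ) ≤ J s := by exact_mod_cast Nat.one_le_iff_ne_zero.2 h0
    have c2n : 1 ≤ N - 1 - J s := by omega
    have c2 : (1 : ℝ) ≤ ((N - 1 - J s : ℕ) : ℝ) := by exact_mod_cast c2n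
    have c3 : ((N - 1 - J s : ℕ) : ℝ) = N - 1 - J s := by
      rw [Nat.cast_sub (by omega), Nat.cast_sub (by omega)]; simp
    have a1 := hJle s
    have b1 := hJlt' s
    have f0 : 0 < Int.fract (β s) := by
      by_contra h
      nlinarith
    have f1 := Int.fract_lt_one (β s)
    have e : dirichletSum K (β s) = dirichletSum K (Int.fract (β s)) :=
      sum_congr rfl fun k _ => expi_fract _ _
    rw [e]
    refine (norm_sq_dirichletSum_le K f0 f1).trans ?_
    have g1 : 1 / (4 * Int.fract (β s) ^ 2) ≤ (N : ℝ) ^ 2 / 4 * ((J s : ℝ) ^ 2)⁻¹ := by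
      rw [← div_eq_mul_inv, div_div, div_le_div_iff₀ (by positivity) (by positivity)]
      have : (J s : ℝ) ^ 2 ≤ (Int.fract (β s) * N) ^ 2 := by gcongr
      nlinarith
    have g2 : 1 / (4 * (1 - Int.fract (β s)) ^ 2) ≤
        (N : ℝ) ^ 2 / 4 * (((N - 1 - J s : ℕ) : ℝ) ^ 2)⁻¹ := by
      have : 0 < 1 - Int.fract (β s) := by linarith
      rw [← div_eq_mul_inv, div_div, div_le_div_iff₀ (by positivity) (by positivity)]
      have : ((N - 1 - J s : ℕ) : ℝ) ^ 2 ≤ ((1 - Int.fract (β s)) * N) ^ 2 := by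
        gcongr; rw [c3]; linarith
      nlinarith
    linarith
  calc ∑ s ∈ R, ‖dirichletSum K (β s)‖ ^ 2 ≤ ∑ s ∈ R, G (J s) := sum_le_sum fun s _ => hle s
    _ = ∑ j ∈ R.image J, G j := (sum_image hinj).symm
    _ ≤ ∑ j ∈ range N, G j := by
        refine sum_le_sum_of_subset_of_nonneg ?_ fun j _ _ => hG0 j
        intro j hj
        obtain ⟨s, _, rfl⟩ := mem_image.1 hj
        exact mem_range.2 (hJlt s)
    _ ≤ 2 * (K : ℝ) ^ 2 + (N : ℝ) ^ 2 := by
        simp only [hG, sum_add_distrib, ← mul_sum]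
        rw [sum_range_reflect (fun j => ((j : ℝ) ^ 2)⁻¹) N]
        have := sum_range_inv_sq_le_two N
        have k1 : ∑ j ∈ range N, (if j = 0 then (K : ℝ) ^ 2 else 0) ≤ (K : ℝ) ^ 2 := by
          rw [sum_ite_eq']; split_ifs <;> first | exact le_rfl | positivity
        have k2 : ∑ j ∈ range N, (if j = N - 1 then (K : ℝ) ^ 2 else 0) ≤ (K : ℝ) ^ 2 := by
          rw [sum_ite_eq']; split_ifs <;> first | exact le_rfl | positivity
        have k3 : (N : ℝ) ^ 2 / 4 * ∑ i ∈ range N, ((i : ℝ) ^ 2)⁻¹ ≤ (N : ℝ) ^ 2 / 4 * 2 := by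
          gcongr
        linarith

/-- Dual form of the large sieve for points whose differences are spaced. -/
theorem dual_large_sieve {ι : Type*} (R : Finset ι) (α : ι → ℝ) (N L : ℕ) (hN : 0 < N)
    (hα : ∀ r ∈ R, ∀ s ∈ R, ∀ t ∈ R, s ≠ t →
      1 / (N : ℝ) ≤ |Int.fract (α r - α s) - Int.fract (α r - α t)|) (c : ι → ℂ) :
    ∑ n ∈ Icc (-(L : ℤ)) L, ‖∑ r ∈ R, c r * expi (n * α r)‖ ^ 2 ≤
      12 * (2 * (L : ℝ) + N) * ∑ r ∈ R, ‖c r‖ ^ 2 := by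
  set T : ℤ → ℂ := fun n => ∑ r ∈ R, c r * expi (n * α r) with hT
  set M : ℕ := 2 * L + N with hM
  set K : ℕ := 2 * L + M with hK
  have hMpos : 0 < M := by omega
  have hMr : (M : ℝ) = 2 * L + N := by rw [hM]; push_cast; ring
  have hM0 : (0 : ℝ) < M := by exact_mod_cast hMpos
  rw [← hMr]
  set W : ℝ := ∑ l ∈ range K, ∑ k ∈ range K, ‖T ((k : ℤ) - l)‖ ^ 2 with hW
  have lower : (M : ℝ) * ∑ n ∈ Icc (-(L : ℤ)) L, ‖T n‖ ^ 2 ≤ W := by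
    have h1 : ∀ l ∈ Ico L (L + M), ∑ n ∈ Icc (-(L : ℤ)) L, ‖T n‖ ^ 2 ≤
        ∑ k ∈ range K, ‖T ((k : ℤ) - l)‖ ^ 2 := by
      intro l hl
      rw [mem_Ico] at hl
      have hinj : Set.InjOn (fun k : ℕ => (k : ℤ) - l) (range K) := by
        intro a _ b _ hab
        have hab' : (a : ℤ) - l = b - l := hab
        omega
      rw [← sum_image (f := fun n => ‖T n‖ ^ 2) hinj]
      refine sum_le_sum_of_subset_of_nonneg ?_ fun _ _ _ => by positivity
      intro n hn
      rw [mem_Icc] at hn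
      refine mem_image.2 ⟨(n + l).toNat, mem_range.2 (by omega), ?_⟩
      omega
    calc (M : ℝ) * ∑ n ∈ Icc (-(L : ℤ)) L, ‖T n‖ ^ 2
        = ∑ l ∈ Ico L (L + M), ∑ n ∈ Icc (-(L : ℤ)) L, ‖T n‖ ^ 2 := by simp
      _ ≤ ∑ l ∈ Ico L (L + M), ∑ k ∈ range K, ‖T ((k : ℤ) - l)‖ ^ 2 := sum_le_sum h1
      _ ≤ W := by
          refine sum_le_sum_of_subset_of_nonneg ?_ fun _ _ _ => sum_nonneg fun _ _ => by positivity
          intro l hl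
          rw [mem_Ico] at hl
          exact mem_range.2 (by omega)
  have hWeq : (W : ℂ) = ∑ r ∈ R, ∑ s ∈ R, c r * (starRingEnd ℂ) (c s) *
      ((‖dirichletSum K (α r - α s)‖ ^ 2 : ℝ) : ℂ) := by
    have h1 : ∀ k l : ℕ, ((‖T ((k : ℤ) - l)‖ ^ 2 : ℝ) : ℂ) = ∑ r ∈ R, ∑ s ∈ R,
        c r * (starRingEnd ℂ) (c s) * (expi (k * (α r - α s)) *
          (starRingEnd ℂ) (expi (l * (α r - α s)))) := by
      intro k l
      rw [← Complex.normSq_eq_norm_sq, ← Complex.mul_conj, hT]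
      simp only [map_sum, map_mul, sum_mul_sum]
      refine sum_congr rfl fun r _ => sum_congr rfl fun s _ => ?_
      have : expi (((k : ℤ) - (l : ℤ) : ℤ) * α r) * (starRingEnd ℂ)
          (expi (((k : ℤ) - (l : ℤ) : ℤ) * α s)) = expi (k * (α r - α s)) *
          (starRingEnd ℂ) (expi (l * (α r - α s))) := by
        rw [conj_expi, conj_expi, ← expi_add, ← expi_add]
        push_cast; ring_nf
      rw [← this]; ring
    have h2 : ∀ β : ℝ, ((‖dirichletSum K β‖ ^ 2 : ℝ) : ℂ) = ∑ l ∈ range K, ∑ k ∈ range K,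
        (expi (k * β) * (starRingEnd ℂ) (expi (l * β))) := by
      intro β
      rw [← Complex.normSq_eq_norm_sq, ← Complex.mul_conj]
      simp only [dirichletSum, map_sum, sum_mul_sum]
      rw [sum_comm]
    simp only [hW, Complex.ofReal_sum, h1, h2, mul_sum]
    calc _ = ∑ l ∈ range K, ∑ r ∈ R, ∑ s ∈ R, ∑ k ∈ range K, c r * (starRingEnd ℂ) (c s) *
          (expi (k * (α r - α s)) * (starRingEnd ℂ) (expi (l * (α r - α s)))) := by
            refine sum_congr rfl fun l _ => ?_
            rw [sum_comm]
            exact sum_congr rfl fun r _ => sum_comm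
      _ = _ := by
            rw [sum_comm]
            exact sum_congr rfl fun r _ => sum_comm
  have hrow : ∀ r ∈ R, ∑ s ∈ R, ‖dirichletSum K (α r - α s)‖ ^ 2 ≤ 12 * (M : ℝ) ^ 2 := by
    intro r hr
    refine (sum_norm_sq_dirichletSum_le R (fun s => α r - α s) K N hN (hα r hr)).trans ?_
    have a1 : (K : ℝ) ≤ 2 * M := by exact_mod_cast (by omega : K ≤ 2 * M)
    have a2 : (N : ℝ) ≤ M := by exact_mod_cast (by omega : N ≤ M)
    nlinarith [Nat.cast_nonneg (α := ℝ) K, Nat.cast_nonneg (α := ℝ) N]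
  have hsymm : ∀ β : ℝ, ‖dirichletSum K (-β)‖ = ‖dirichletSum K β‖ := by
    intro β
    have : dirichletSum K (-β) = (starRingEnd ℂ) (dirichletSum K β) := by
      simp only [dirichletSum, map_sum, conj_expi]
      exact sum_congr rfl fun k _ => by ring_nf
    rw [this, Complex.norm_conj]
  have upper : W ≤ 12 * (M : ℝ) ^ 2 * ∑ r ∈ R, ‖c r‖ ^ 2 := by
    have hW0 : 0 ≤ W := sum_nonneg fun _ _ => sum_nonneg fun _ _ => by positivity
    have : W = ‖(W : ℂ)‖ := by rw [Complex.norm_real, Real.norm_of_nonneg hW0]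
    rw [this, hWeq]
    have hsw : ∑ r ∈ R, ∑ s ∈ R, ‖c s‖ ^ 2 * ‖dirichletSum K (α r - α s)‖ ^ 2 =
        ∑ r ∈ R, ∑ s ∈ R, ‖c r‖ ^ 2 * ‖dirichletSum K (α r - α s)‖ ^ 2 := by
      rw [sum_comm]
      refine sum_congr rfl fun r _ => sum_congr rfl fun s _ => ?_
      rw [← hsymm, neg_sub]
    calc _ ≤ ∑ r ∈ R, ∑ s ∈ R, (‖c r‖ ^ 2 * ‖dirichletSum K (α r - α s)‖ ^ 2 / 2 +
          ‖c s‖ ^ 2 * ‖dirichletSum K (α r - α s)‖ ^ 2 / 2) := by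
          refine (norm_sum_le _ _).trans (sum_le_sum fun r _ =>
            (norm_sum_le _ _).trans (sum_le_sum fun s _ => ?_))
          rw [norm_mul, norm_mul, Complex.norm_conj, Complex.norm_real,
            Real.norm_of_nonneg (by positivity)]
          nlinarith [mul_nonneg (sq_nonneg (‖c r‖ - ‖c s‖))
            (sq_nonneg ‖dirichletSum K (α r - α s)‖)]
      _ = ∑ r ∈ R, ‖c r‖ ^ 2 * ∑ s ∈ R, ‖dirichletSum K (α r - α s)‖ ^ 2 := by
          simp only [sum_add_distrib, ← sum_div, hsw, mul_sum]
          ring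
      _ ≤ ∑ r ∈ R, ‖c r‖ ^ 2 * (12 * (M : ℝ) ^ 2) := by
          refine sum_le_sum fun r hr => ?_
          gcongr
          exact hrow r hr
      _ = _ := by rw [← sum_mul]; ring
  have := lower.trans upper
  have h3 : (M : ℝ) * ∑ n ∈ Icc (-(L : ℤ)) L, ‖T n‖ ^ 2 ≤
      M * (12 * M * ∑ r ∈ R, ‖c r‖ ^ 2) := by linarith
  exact le_of_mul_le_mul_left h3 hM0

theorem large_sieve {ι : Type*} (R : Finset ι) (α : ι → ℝ) (N L : ℕ) (hN : 0 < N)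
    (hα : ∀ r ∈ R, ∀ s ∈ R, ∀ t ∈ R, s ≠ t →
      1 / (N : ℝ) ≤ |Int.fract (α r - α s) - Int.fract (α r - α t)|) (a : ℤ → ℝ) :
    ∑ r ∈ R, ‖∑ n ∈ Icc (-(L : ℤ)) L, (a n : ℂ) * expi (n * α r)‖ ^ 2 ≤
      12 * (2 * (L : ℝ) + N) * ∑ n ∈ Icc (-(L : ℤ)) L, a n ^ 2 := by
  set S : ι → ℂ := fun r => ∑ n ∈ Icc (-(L : ℤ)) L, (a n : ℂ) * expi (n * α r) with hS
  set c : ι → ℂ := fun r => (starRingEnd ℂ) (S r) with hc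
  set X : ℝ := ∑ r ∈ R, ‖S r‖ ^ 2 with hX
  set T : ℤ → ℂ := fun n => ∑ r ∈ R, c r * expi (n * α r) with hT
  have hX0 : 0 ≤ X := sum_nonneg fun _ _ => by positivity
  have hdual := dual_large_sieve R α N L hN hα c
  have hcX : ∑ r ∈ R, ‖c r‖ ^ 2 = X := by simp [hc, hX]
  rw [hcX] at hdual
  have e1 : (X : ℂ) = ∑ n ∈ Icc (-(L : ℤ)) L, (a n : ℂ) * T n := by
    have : (X : ℂ) = ∑ r ∈ R, c r * S r := by
      rw [hX]; push_cast
      refine sum_congr rfl fun r _ => ?_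
      rw [hc, mul_comm, Complex.mul_conj, Complex.normSq_eq_norm_sq]; push_cast; rfl
    rw [this]
    simp only [hS, hT, mul_sum]
    rw [sum_comm]
    exact sum_congr rfl fun _ _ => sum_congr rfl fun _ _ => by ring
  have e2 : X ≤ ∑ n ∈ Icc (-(L : ℤ)) L, |a n| * ‖T n‖ := by
    have : X = ‖(X : ℂ)‖ := by rw [Complex.norm_real, Real.norm_of_nonneg hX0]
    rw [this, e1]
    refine (norm_sum_le _ _).trans (sum_le_sum fun n _ => ?_)
    rw [norm_mul, Complex.norm_real, Real.norm_eq_abs]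
  have e3 := sum_mul_sq_le_sq_mul_sq (Icc (-(L : ℤ)) L) (fun n => |a n|) (fun n => ‖T n‖)
  simp only [sq_abs] at e3
  have e4 : X ^ 2 ≤ (∑ n ∈ Icc (-(L : ℤ)) L, a n ^ 2) * (12 * (2 * (L : ℝ) + N) * X) := by
    calc X ^ 2 ≤ (∑ n ∈ Icc (-(L : ℤ)) L, |a n| * ‖T n‖) ^ 2 := by gcongr
      _ ≤ _ := e3
      _ ≤ _ := by
        gcongr
  have hA : 0 ≤ ∑ n ∈ Icc (-(L : ℤ)) L, a n ^ 2 := sum_nonneg fun _ _ => by positivity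
  rcases hX0.eq_or_lt with h | h
  · change X ≤ _
    rw [← h]; positivity
  · change X ≤ _
    nlinarith

/-- The large sieve term `∑_{0<b<p} |∑_{|n| ≤ L} a_n e(nb/p)|²` at the modulus `p`. -/
def lsTerm (p L : ℕ) (a : ℤ → ℝ) : ℝ :=
  ∑ b ∈ Ioo 0 p, ‖∑ n ∈ Icc (-(L : ℤ)) L, (a n : ℂ) * expi (n * ((b : ℝ) / p))‖ ^ 2

theorem lsTerm_nonneg (p L : ℕ) (a : ℤ → ℝ) : 0 ≤ lsTerm p L a :=
  sum_nonneg fun _ _ => by positivity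

theorem abs_fract_sub_fract_ge {p q b c Q : ℕ} (hp : p.Prime) (hq : q.Prime) (hpQ : p ≤ Q)
    (hqQ : q ≤ Q) (hb : b ∈ Ioo 0 p) (hc : c ∈ Ioo 0 q) (hne : ¬ (p = q ∧ b = c)) (x : ℝ) :
    1 / ((Q ^ 2 : ℕ) : ℝ) ≤ |Int.fract (x - (b : ℝ) / p) - Int.fract (x - (c : ℝ) / q)| := by
  rw [mem_Ioo] at hb hc
  have hp0 : (0 : ℝ) < p := by exact_mod_cast hp.pos
  have hq0 : (0 : ℝ) < q := by exact_mod_cast hq.pos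
  set m : ℤ := ⌊x - (c : ℝ) / q⌋ - ⌊x - (b : ℝ) / p⌋ with hm
  set k : ℤ := c * p - b * q + m * p * q with hk
  have e : Int.fract (x - (b : ℝ) / p) - Int.fract (x - (c : ℝ) / q) = k / (p * q) := by
    rw [Int.fract, Int.fract, hk, hm]
    push_cast
    field_simp
    ring
  have hk0 : k ≠ 0 := by
    intro h0
    have h1 : (c : ℤ) * p = q * (b - m * p) := by linarith
    by_cases hpq : p = q
    · subst hpq
      have h2 : (c : ℤ) = b - m * p := by
        have : (p : ℤ) ≠ 0 := by exact_mod_cast hp.ne_zero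
        apply mul_left_cancel₀ this; linarith
      have h3 : (p : ℤ) ∣ b - c := ⟨m, by linarith⟩
      have h4 : ((b : ℤ) - c) = 0 := by
        apply Int.eq_zero_of_abs_lt_dvd h3
        rw [abs_lt]; constructor <;> omega
      exact hne ⟨rfl, by omega⟩
    · have h2 : (q : ℤ) ∣ c * p := ⟨_, h1⟩
      have h3 : q ∣ c * p := by exact_mod_cast h2
      have h4 : q ∣ c := Nat.Coprime.dvd_of_dvd_mul_right
        ((Nat.coprime_primes hq hp).2 (Ne.symm hpq)) h3
      exact absurd (Nat.le_of_dvd hc.1 h4) (by omega)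
  rw [e, abs_div, abs_of_pos (mul_pos hp0 hq0)]
  have h1 : (1 : ℝ) ≤ |(k : ℝ)| := by exact_mod_cast Int.one_le_abs hk0
  have h2 : (p : ℝ) * q ≤ ((Q ^ 2 : ℕ) : ℝ) := by
    rw [sq]; exact_mod_cast Nat.mul_le_mul hpQ hqQ
  gcongr

theorem sum_lsTerm_le (Q L : ℕ) (hQ : 0 < Q) (a : ℤ → ℝ) :
    ∑ p ∈ (range (Q + 1)).filter Nat.Prime, lsTerm p L a ≤
      12 * (2 * (L : ℝ) + (Q : ℝ) ^ 2) * ∑ n ∈ Icc (-(L : ℤ)) L, a n ^ 2 := by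
  have := large_sieve (((range (Q + 1)).filter Nat.Prime).sigma fun p => Ioo 0 p)
    (fun r => (r.2 : ℝ) / r.1) (Q ^ 2) L (by positivity) ?_ a
  · rw [sum_sigma] at this
    push_cast at this
    exact this
  · rintro r - ⟨p, b⟩ hs ⟨q, c⟩ ht hne
    simp only [mem_sigma, mem_filter, mem_range] at hs ht
    refine abs_fract_sub_fract_ge hs.1.2 ht.1.2 (by omega) (by omega) hs.2 ht.2 ?_ _
    rintro ⟨rfl, rfl⟩
    exact hne rfl

/-- The pushforward to `ZMod p` of the weight `a` on `[-L, L]`. -/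
def resSum (p L : ℕ) (a : ℤ → ℝ) (h : ZMod p) : ℝ :=
  ∑ n ∈ Icc (-(L : ℤ)) L, if (n : ZMod p) = h then a n else 0

theorem sum_expi_div {p : ℕ} (hp : 0 < p) (m : ℤ) :
    ∑ b ∈ range p, expi (m * ((b : ℝ) / p)) = if (m : ZMod p) = 0 then (p : ℂ) else 0 := by
  have hp0 : (p : ℝ) ≠ 0 := by positivity
  have e : ∀ b : ℕ, expi (m * ((b : ℝ) / p)) = expi (m / p) ^ b := by
    intro b; rw [← expi_nat_mul]; congr 1; ring
  simp only [e]
  split_ifs with h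
  · rw [ZMod.intCast_zmod_eq_zero_iff_dvd] at h
    obtain ⟨k, rfl⟩ := h
    have : expi (((p * k : ℤ) : ℝ) / p) = 1 := by
      rw [← expi_int k]; congr 1; push_cast; field_simp
    simp only [this, one_pow]; simp
  · have hne : expi ((m : ℝ) / p) ≠ 1 := by
      intro h1
      apply h
      unfold expi at h1
      rw [Complex.exp_eq_one_iff] at h1
      obtain ⟨k, hk⟩ := h1
      rw [ZMod.intCast_zmod_eq_zero_iff_dvd]
      refine ⟨k, ?_⟩
      have h2 : (((m : ℝ) / p : ℝ) : ℂ) = k := by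
        have : (2 * Real.pi * Complex.I : ℂ) ≠ 0 := Complex.two_pi_I_ne_zero
        apply mul_left_cancel₀ this
        linear_combination hk
      have h3 : (m : ℝ) / p = k := by exact_mod_cast h2
      rw [div_eq_iff hp0] at h3
      have h4 : m = k * p := by exact_mod_cast h3
      rw [h4, mul_comm]
    rw [geom_sum_eq hne, ← expi_nat_mul]
    have : (p : ℝ) * (m / p) = m := by field_simp
    rw [this, expi_int]; simp

section ResidueSums

variable {p : ℕ} [Fact p.Prime]

theorem lsTerm_eq (L : ℕ) (a : ℤ → ℝ) :
    lsTerm p L a = p * ∑ h : ZMod p, resSum p L a h ^ 2 -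
      (∑ n ∈ Icc (-(L : ℤ)) L, a n) ^ 2 := by
  have hp : 0 < p := (Fact.out : p.Prime).pos
  set I := Icc (-(L : ℤ)) L
  set S : ℕ → ℂ := fun b => ∑ n ∈ I, (a n : ℂ) * expi (n * ((b : ℝ) / p)) with hS
  have h1 : ∑ b ∈ range p, ‖S b‖ ^ 2 = lsTerm p L a + (∑ n ∈ I, a n) ^ 2 := by
    have hr : range p = insert 0 (Ioo 0 p) := by
      ext b; simp only [mem_range, mem_insert, mem_Ioo]; omega
    rw [hr, sum_insert (by simp), add_comm, lsTerm]
    have h0 : S 0 = ((∑ n ∈ I, a n : ℝ) : ℂ) := by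
      have : expi 0 = 1 := by simpa using expi_int 0
      simp [hS, this]
    rw [h0, Complex.norm_real, Real.norm_eq_abs, sq_abs]
  have h2 : ((∑ b ∈ range p, ‖S b‖ ^ 2 : ℝ) : ℂ) =
      ((p * ∑ h : ZMod p, resSum p L a h ^ 2 : ℝ) : ℂ) := by
    have e : ∀ b, ((‖S b‖ ^ 2 : ℝ) : ℂ) = ∑ n ∈ I, ∑ m ∈ I, (a n : ℂ) * a m *
        expi (((n - m : ℤ) : ℝ) * ((b : ℝ) / p)) := by
      intro b
      rw [← Complex.normSq_eq_norm_sq, ← Complex.mul_conj, hS]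
      simp only [map_sum, map_mul, sum_mul_sum, Complex.conj_ofReal, conj_expi]
      refine sum_congr rfl fun n _ => sum_congr rfl fun m _ => ?_
      have : expi (((n - m : ℤ) : ℝ) * ((b : ℝ) / p)) =
          expi (n * ((b : ℝ) / p)) * expi (-(m * ((b : ℝ) / p))) := by
        rw [← expi_add]; push_cast; ring_nf
      rw [this]; ring
    have l : ((∑ b ∈ range p, ‖S b‖ ^ 2 : ℝ) : ℂ) = ∑ n ∈ I, ∑ m ∈ I, (a n : ℂ) * a m *
        (if (n : ZMod p) = m then (p : ℂ) else 0) := by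
      rw [Complex.ofReal_sum]
      simp only [e]
      rw [sum_comm]
      refine sum_congr rfl fun n _ => ?_
      rw [sum_comm]
      refine sum_congr rfl fun m _ => ?_
      rw [← mul_sum, sum_expi_div hp]
      simp only [Int.cast_sub, sub_eq_zero]
    have r : ∑ h : ZMod p, resSum p L a h ^ 2 = ∑ n ∈ I, ∑ m ∈ I, a n * a m *
        (if (n : ZMod p) = m then (1 : ℝ) else 0) := by
      simp only [resSum, sq, sum_mul_sum]
      rw [sum_comm]
      refine sum_congr rfl fun n _ => ?_
      rw [sum_comm]
      refine sum_congr rfl fun m _ => ?_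
      simp only [ite_mul, zero_mul, sum_ite_eq, mem_univ, if_true]
      by_cases h : (n : ZMod p) = m
      · simp [h]
      · simp [h, Ne.symm h]
    rw [l, r]
    push_cast
    simp only [mul_sum]
    refine sum_congr rfl fun n _ => sum_congr rfl fun m _ => ?_
    split_ifs <;> simp; ring
  have h3 : ∑ b ∈ range p, ‖S b‖ ^ 2 = p * ∑ h : ZMod p, resSum p L a h ^ 2 := by
    exact_mod_cast h2
  linarith

theorem sum_resSum (L : ℕ) (a : ℤ → ℝ) :
    ∑ h : ZMod p, resSum p L a h = ∑ n ∈ Icc (-(L : ℤ)) L, a n := by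
  simp only [resSum]
  rw [sum_comm]
  exact sum_congr rfl fun n _ => by simp

/-- The mean of a real function on a finite type. -/
def mean {G : Type*} [Fintype G] (u : G → ℝ) : ℝ := (∑ g, u g) / Fintype.card G

theorem sum_sub_mean_sq_le {G : Type*} [Fintype G] [Nonempty G] (u : G → ℝ) (c : ℝ) :
    ∑ g, (u g - mean u) ^ 2 ≤ ∑ g, (u g - c) ^ 2 := by
  have hc : (0 : ℝ) < Fintype.card G := by exact_mod_cast Fintype.card_pos
  have h : ∑ g, u g = mean u * Fintype.card G := by
    rw [mean]; field_simp
  have e : ∀ d : ℝ, ∑ g, (u g - d) ^ 2 =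
      ∑ g, u g ^ 2 - 2 * d * (mean u * Fintype.card G) + Fintype.card G * d ^ 2 := by
    intro d
    rw [← h, mul_sum, ← sum_sub_distrib]
    have : (Fintype.card G : ℝ) * d ^ 2 = ∑ _g : G, d ^ 2 := by simp
    rw [this, ← sum_add_distrib]
    exact sum_congr rfl fun g _ => by ring
  rw [e, e]
  nlinarith [mul_nonneg hc.le (sq_nonneg (c - mean u))]

theorem units_variance_le_lsTerm (L : ℕ) (a : ℤ → ℝ) :
    p * ∑ g : (ZMod p)ˣ, (resSum p L a g - mean fun g : (ZMod p)ˣ => resSum p L a g) ^ 2 ≤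
      lsTerm p L a := by
  have hp : 0 < p := (Fact.out : p.Prime).pos
  have hp0 : (0 : ℝ) < p := by exact_mod_cast hp
  set Z := ∑ n ∈ Icc (-(L : ℤ)) L, a n with hZ
  have h1 := sum_sub_mean_sq_le (fun g : (ZMod p)ˣ => resSum p L a g) (Z / p)
  have h2 : ∑ g : (ZMod p)ˣ, (resSum p L a g - Z / p) ^ 2 ≤
      ∑ h : ZMod p, (resSum p L a h - Z / p) ^ 2 := by
    rw [← sum_image (s := (univ : Finset (ZMod p)ˣ)) (g := fun g : (ZMod p)ˣ => (g : ZMod p))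
      (f := fun h => (resSum p L a h - Z / p) ^ 2) (Units.val_injective.injOn)]
    exact sum_le_sum_of_subset_of_nonneg (subset_univ _) fun _ _ _ => by positivity
  have h3 : p * ∑ h : ZMod p, (resSum p L a h - Z / p) ^ 2 = lsTerm p L a := by
    rw [lsTerm_eq, ← hZ]
    have : ∀ h : ZMod p, (resSum p L a h - Z / p) ^ 2 =
        resSum p L a h ^ 2 - 2 * (Z / p) * resSum p L a h + (Z / p) ^ 2 := fun h => by ring
    simp only [this, sum_add_distrib, sum_sub_distrib, ← mul_sum, sum_resSum, ← hZ]
    simp only [sum_const, card_univ, ZMod.card, nsmul_eq_mul]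
    field_simp
    ring
  rw [← h3]
  exact mul_le_mul_of_nonneg_left (h1.trans h2) hp0.le

end ResidueSums

section Convolution

variable {G : Type*} [CommGroup G] [Fintype G]

/-- Convolution of two real functions on a finite commutative group. -/
def conv (F H : G → ℝ) (g : G) : ℝ := ∑ s, F s * H (s⁻¹ * g)

/-- The autocorrelation of a real function on a finite commutative group. -/
def autocorr (F : G → ℝ) (t : G) : ℝ := ∑ g, F g * F (g * t)

/-- `iterConv F j` is the `2 ^ j`-th convolution power of `F`. -/
def iterConv (F : G → ℝ) : ℕ → G → ℝ
  | 0 => F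
  | j + 1 => conv (iterConv F j) (iterConv F j)

/-- The average of `F` over the translates by `m`-th powers. -/
def powAvg (m : ℕ) (F : G → ℝ) (h : G) : ℝ :=
  (∑ t, F (h * t ^ m)) / Fintype.card G

theorem sum_mul_right_eq (F : G → ℝ) (t : G) : ∑ g, F (g * t) = ∑ g, F g :=
  Fintype.sum_equiv (Equiv.mulRight t) _ _ fun _ => rfl

theorem sum_mul_left_eq (F : G → ℝ) (t : G) : ∑ g, F (t * g) = ∑ g, F g :=
  Fintype.sum_equiv (Equiv.mulLeft t) _ _ fun _ => rfl

theorem card_pos_real : (0 : ℝ) < Fintype.card G := by exact_mod_cast Fintype.card_pos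

theorem sum_conv_sq (F : G → ℝ) : ∑ g, conv F F g ^ 2 = ∑ t, autocorr F t ^ 2 := by
  have l : ∑ g, conv F F g ^ 2 = ∑ t, ∑ s, ∑ u, F s * F u * (F t * F (t⁻¹ * s * u)) := by
    simp only [conv, sq, sum_mul_sum]
    calc _ = ∑ s, ∑ t, ∑ g, F s * F (s⁻¹ * g) * (F t * F (t⁻¹ * g)) := by
          rw [sum_comm]; exact sum_congr rfl fun s _ => sum_comm
      _ = ∑ s, ∑ t, ∑ u, F s * F u * (F t * F (t⁻¹ * s * u)) := by
          refine sum_congr rfl fun s _ => sum_congr rfl fun t _ => ?_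
          rw [← sum_mul_left_eq (fun g => F s * F (s⁻¹ * g) * (F t * F (t⁻¹ * g))) s]
          exact sum_congr rfl fun u _ => by simp [mul_assoc]
      _ = _ := sum_comm
  have r : ∑ t, autocorr F t ^ 2 = ∑ t, ∑ v, ∑ u, F (t * v) * F u * (F t * F (v * u)) := by
    simp only [autocorr, sq, sum_mul_sum]
    rw [sum_comm]
    refine sum_congr rfl fun t _ => sum_congr rfl fun v _ => sum_congr rfl fun u _ => ?_
    rw [mul_comm u v]; ring
  rw [l, r]
  refine sum_congr rfl fun t _ => ?_
  rw [← sum_mul_left_eq (fun s => ∑ u, F s * F u * (F t * F (t⁻¹ * s * u))) t]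
  exact sum_congr rfl fun v _ => by simp

theorem sum_conv (F H : G → ℝ) : ∑ g, conv F H g = (∑ g, F g) * ∑ g, H g := by
  simp only [conv]
  rw [sum_comm, sum_mul]
  refine sum_congr rfl fun s _ => ?_
  rw [← mul_sum, sum_mul_left_eq]

theorem conv_sub_mean (F : G → ℝ) :
    conv (fun g => F g - mean F) (fun g => F g - mean F) =
      fun g => conv F F g - mean (conv F F) := by
  have hc := card_pos_real (G := G)
  have hF : ∑ g, F g = mean F * Fintype.card G := by rw [mean]; field_simp
  have hm : mean (conv F F) = mean F ^ 2 * Fintype.card G := by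
    rw [mean, sum_conv, hF]; field_simp
  funext g
  rw [hm]
  have hF' : ∑ s, F (s⁻¹ * g) = mean F * Fintype.card G := by
    rw [← hF]
    exact Fintype.sum_equiv ((Equiv.inv G).trans (Equiv.mulRight g)) _ _ fun _ => rfl
  simp only [conv]
  have : ∀ s, (F s - mean F) * (F (s⁻¹ * g) - mean F) =
      F s * F (s⁻¹ * g) - mean F * F s - mean F * F (s⁻¹ * g) + mean F ^ 2 := fun s => by ring
  simp only [this, sum_add_distrib, sum_sub_distrib, ← mul_sum, hF, hF']
  simp only [sum_const, card_univ, nsmul_eq_mul]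
  ring

theorem iterConv_sub_mean (F : G → ℝ) (j : ℕ) :
    iterConv (fun g => F g - mean F) j = fun g => iterConv F j g - mean (iterConv F j) := by
  induction j with
  | zero => rfl
  | succ j ih => rw [iterConv, ih, conv_sub_mean]; rfl

theorem powAvg_mul_pow (m : ℕ) (F : G → ℝ) (h t : G) : powAvg m F (h * t ^ m) = powAvg m F h := by
  unfold powAvg
  congr 1
  rw [← sum_mul_left_eq (fun s => F (h * s ^ m)) t]
  exact sum_congr rfl fun s _ => by rw [mul_pow, mul_assoc]

theorem powAvg_conv (m : ℕ) (F H : G → ℝ) :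
    powAvg m (conv F H) = conv (powAvg m F) (powAvg m H) := by
  have hc := card_pos_real (G := G)
  funext g
  have h1 : conv (powAvg m F) (powAvg m H) g = ∑ s, (∑ t, F (s * t ^ m)) / Fintype.card G *
      powAvg m H (s⁻¹ * g) := rfl
  have h2 : conv (powAvg m F) (powAvg m H) g = ∑ s, F s * powAvg m H (s⁻¹ * g) := by
    rw [h1]
    have : ∀ s, (∑ t, F (s * t ^ m)) / Fintype.card G * powAvg m H (s⁻¹ * g) =
        (∑ t, F (s * t ^ m) * powAvg m H ((s * t ^ m)⁻¹ * g)) / Fintype.card G := by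
      intro s
      rw [div_mul_eq_mul_div, sum_mul]
      congr 1
      refine sum_congr rfl fun t _ => ?_
      have := powAvg_mul_pow m H ((s * t ^ m)⁻¹ * g) t
      rw [← this]
      congr 2
      rw [mul_inv]
      rw [mul_assoc, mul_assoc, mul_comm g, ← mul_assoc (t ^ m)⁻¹, inv_mul_cancel, one_mul]
    simp only [this]
    rw [← sum_div, sum_comm]
    have : ∀ t : G, ∑ s, F (s * t ^ m) * powAvg m H ((s * t ^ m)⁻¹ * g) =
        ∑ s, F s * powAvg m H (s⁻¹ * g) := fun t =>
      sum_mul_right_eq (fun s => F s * powAvg m H (s⁻¹ * g)) _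
    simp only [this, sum_const, card_univ, nsmul_eq_mul]
    field_simp
  rw [h2]
  simp only [powAvg, conv, mul_div_assoc', mul_sum]
  rw [← sum_div, sum_comm]
  simp only [mul_assoc]

theorem powAvg_iterConv (m : ℕ) (F : G → ℝ) (j : ℕ) :
    powAvg m (iterConv F j) = iterConv (powAvg m F) j := by
  induction j with
  | zero => rfl
  | succ j ih => rw [iterConv, powAvg_conv, ih]; rfl

theorem sum_powAvg_sq_le (m : ℕ) (F : G → ℝ) : ∑ h, powAvg m F h ^ 2 ≤ ∑ h, F h ^ 2 := by
  have hc := card_pos_real (G := G)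
  have h1 : ∀ h, powAvg m F h ^ 2 ≤ (∑ t, F (h * t ^ m) ^ 2) / Fintype.card G := by
    intro h
    have := sq_sum_le_card_mul_sum_sq (s := (univ : Finset G)) (f := fun t => F (h * t ^ m))
    rw [card_univ] at this
    rw [powAvg, div_pow, div_le_div_iff₀ (by positivity) hc]
    nlinarith
  calc ∑ h, powAvg m F h ^ 2 ≤ ∑ h, (∑ t, F (h * t ^ m) ^ 2) / Fintype.card G :=
        sum_le_sum fun h _ => h1 h
    _ = ∑ h, F h ^ 2 := by
        rw [← sum_div, sum_comm]
        have : ∀ t : G, ∑ s, F (s * t ^ m) ^ 2 = ∑ s, F s ^ 2 := fun t =>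
          sum_mul_right_eq (fun s => F s ^ 2) _
        simp only [this, sum_const, card_univ, nsmul_eq_mul]
        field_simp

/-- The map `t ↦ t ^ m` on `G` has fibres with at most `m` elements. -/
def PowFiber (G : Type*) [CommGroup G] [Fintype G] (m : ℕ) : Prop :=
  ∀ F : G → ℝ, (∀ g, 0 ≤ F g) → ∑ t, F (t ^ m) ≤ m * ∑ t, F t

theorem iterConv_mul_pow (m : ℕ) (w : G → ℝ) (hw : ∀ h t, w (h * t ^ m) = w h) (j : ℕ) :
    ∀ h t, iterConv w j (h * t ^ m) = iterConv w j h := by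
  induction j with
  | zero => exact hw
  | succ j ih =>
    intro h t
    simp only [iterConv, conv]
    exact sum_congr rfl fun s _ => by rw [← mul_assoc, ih]

theorem sq_le_card_mul_sum_conv_sq {m : ℕ} (hG : PowFiber G m) (w : G → ℝ)
    (hw : ∀ h t, w (h * t ^ m) = w h) :
    (Fintype.card G * ∑ g, w g ^ 2) ^ 2 ≤ m * (Fintype.card G * ∑ g, conv w w g ^ 2) := by
  have h1 : ∀ t : G, autocorr w (t ^ m) = ∑ g, w g ^ 2 := by
    intro t
    simp only [autocorr, hw, sq]
  have h2 := hG (fun t => autocorr w t ^ 2) fun _ => sq_nonneg _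
  simp only [h1, sum_const, card_univ, nsmul_eq_mul] at h2
  rw [sum_conv_sq]
  have hc := card_pos_real (G := G)
  nlinarith

theorem iterConv_sum_sq_ge {m : ℕ} (hm : 0 < m) (hG : PowFiber G m) (w : G → ℝ)
    (hw : ∀ h t, w (h * t ^ m) = w h) (j : ℕ) :
    (m : ℝ) * ((Fintype.card G * ∑ g, w g ^ 2) / m) ^ 2 ^ j ≤
      Fintype.card G * ∑ g, iterConv w j g ^ 2 := by
  have hm' : (0 : ℝ) < m := by exact_mod_cast hm
  induction j with
  | zero => simp only [pow_zero, pow_one, iterConv]; field_simp; exact le_rfl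
  | succ j ih =>
    have h := sq_le_card_mul_sum_conv_sq hG (iterConv w j) (iterConv_mul_pow m w hw j)
    set D := Fintype.card G * ∑ g, iterConv w j g ^ 2
    have h0 : 0 ≤ (m : ℝ) * ((Fintype.card G * ∑ g, w g ^ 2) / m) ^ 2 ^ j := by positivity
    change _ ≤ Fintype.card G * ∑ g, conv (iterConv w j) (iterConv w j) g ^ 2
    set E := Fintype.card G * ∑ g, conv (iterConv w j) (iterConv w j) g ^ 2
    rw [pow_succ, pow_mul]
    set Y := ((Fintype.card G * ∑ g, w g ^ 2) / (m : ℝ)) ^ 2 ^ j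
    have h3 : (m * Y) ^ 2 ≤ m * E := (pow_le_pow_left₀ h0 ih 2).trans h
    have h4 : (m : ℝ) * (m * Y ^ 2) ≤ m * E := by linarith
    exact le_of_mul_le_mul_left h4 hm'

/-- Amplification: a sum of `F` against a weight invariant under `m`-th powers is controlled by
the `2 ^ j`-th convolution power of `F`. -/
theorem amplification {m : ℕ} (hm : 0 < m) (hG : PowFiber G m) (F ψ : G → ℝ)
    (hψ : ∀ h, |ψ h| ≤ 1) (hinv : ∀ h t, ψ (h * t ^ m) = ψ h) (j : ℕ) :
    (m : ℝ) * ((∑ h, ψ h * F h) ^ 2 / m) ^ 2 ^ j ≤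
      Fintype.card G * ∑ g, iterConv F j g ^ 2 := by
  have hc := card_pos_real (G := G)
  have h1 : ∑ h, ψ h * F h = ∑ h, ψ h * powAvg m F h := by
    simp only [powAvg, mul_div_assoc', mul_sum]
    rw [← sum_div, sum_comm]
    have : ∀ t : G, ∑ h, ψ h * F (h * t ^ m) = ∑ h, ψ h * F h := by
      intro t
      rw [← sum_mul_right_eq (fun h => ψ h * F h) (t ^ m)]
      simp only [hinv]
    simp only [this, sum_const, card_univ, nsmul_eq_mul]
    field_simp
  have h2 : (∑ h, ψ h * F h) ^ 2 ≤ Fintype.card G * ∑ h, powAvg m F h ^ 2 := by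
    rw [h1]
    refine (sum_mul_sq_le_sq_mul_sq _ _ _).trans ?_
    gcongr
    calc ∑ h, ψ h ^ 2 ≤ ∑ _h : G, (1 : ℝ) := sum_le_sum fun h _ => by
          rw [← sq_abs]; exact pow_le_one₀ (abs_nonneg _) (hψ h)
      _ = Fintype.card G := by simp
  calc _ ≤ (m : ℝ) * ((Fintype.card G * ∑ h, powAvg m F h ^ 2) / m) ^ 2 ^ j := by gcongr
    _ ≤ Fintype.card G * ∑ g, iterConv (powAvg m F) j g ^ 2 :=
        iterConv_sum_sq_ge hm hG _ (powAvg_mul_pow m F) j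
    _ ≤ _ := by
        rw [← powAvg_iterConv]
        exact mul_le_mul_of_nonneg_left (sum_powAvg_sq_le _ _) hc.le

theorem bilinear_bound {m n : ℕ} (hGm : PowFiber G m) (hGn : PowFiber G n) (f : G → G → ℝ)
    (hf : ∀ g h, |f g h| ≤ 1) (hinv : ∀ g h t, f (g * t ^ m) (h * t ^ n) = f g h) (a b : G → ℝ) :
    (∑ g, ∑ h, f g h * (a g * b h)) ^ 4 ≤ m * n *
      (Fintype.card G * ∑ g, conv a a g ^ 2) * (Fintype.card G * ∑ g, conv b b g ^ 2) := by
  have hc := card_pos_real (G := G)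
  set T := ∑ g, ∑ h, f g h * (a g * b h) with hT
  set K : G → G → ℝ := fun g h => ∑ t, a (g * t ^ m) * b (h * t ^ n) with hK
  have h1 : Fintype.card G * T = ∑ g, ∑ h, f g h * K g h := by
    have : ∀ t : G, ∑ g, ∑ h, f g h * (a (g * t ^ m) * b (h * t ^ n)) = T := by
      intro t
      rw [hT, ← sum_mul_right_eq (fun g => ∑ h, f g h * (a g * b h)) (t ^ m)]
      refine sum_congr rfl fun g _ => ?_
      rw [← sum_mul_right_eq (fun h => f (g * t ^ m) h * (a (g * t ^ m) * b h)) (t ^ n)]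
      exact sum_congr rfl fun h _ => by rw [hinv]
    simp only [hK, mul_sum]
    calc (Fintype.card G : ℝ) * T
        = ∑ t : G, ∑ g, ∑ h, f g h * (a (g * t ^ m) * b (h * t ^ n)) := by simp [this]
      _ = _ := by
        rw [sum_comm]
        exact sum_congr rfl fun g _ => sum_comm
  have h2 : T ^ 2 ≤ ∑ g, ∑ h, K g h ^ 2 := by
    have h3 : (Fintype.card G * T) ^ 2 ≤ (Fintype.card G : ℝ) ^ 2 * ∑ g, ∑ h, K g h ^ 2 := by
      rw [h1]
      simp only [← Fintype.sum_prod_type']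
      refine (sum_mul_sq_le_sq_mul_sq _ (fun x : G × G => f x.1 x.2) _).trans ?_
      gcongr
      calc ∑ x : G × G, f x.1 x.2 ^ 2 ≤ ∑ _x : G × G, (1 : ℝ) := sum_le_sum fun x _ => by
            rw [← sq_abs]; exact pow_le_one₀ (abs_nonneg _) (hf _ _)
        _ = (Fintype.card G : ℝ) ^ 2 := by simp [sq]
    rw [mul_pow] at h3
    exact le_of_mul_le_mul_left h3 (by positivity)
  have h3 : ∑ g, ∑ h, K g h ^ 2 =
      Fintype.card G * ∑ t : G, autocorr a (t ^ m) * autocorr b (t ^ n) := by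
    have e1 : ∑ g, ∑ h, K g h ^ 2 = ∑ s, ∑ t, (∑ g, a (g * s ^ m) * a (g * t ^ m)) *
        ∑ h, b (h * s ^ n) * b (h * t ^ n) := by
      simp only [hK, sq, sum_mul_sum]
      calc _ = ∑ g, ∑ s, ∑ h, ∑ t, a (g * s ^ m) * b (h * s ^ n) *
            (a (g * t ^ m) * b (h * t ^ n)) := sum_congr rfl fun g _ => sum_comm
        _ = ∑ s, ∑ g, ∑ h, ∑ t, a (g * s ^ m) * b (h * s ^ n) *
            (a (g * t ^ m) * b (h * t ^ n)) := sum_comm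
        _ = ∑ s, ∑ g, ∑ t, ∑ h, a (g * s ^ m) * b (h * s ^ n) *
            (a (g * t ^ m) * b (h * t ^ n)) :=
              sum_congr rfl fun s _ => sum_congr rfl fun g _ => sum_comm
        _ = ∑ s, ∑ t, ∑ g, ∑ h, a (g * s ^ m) * b (h * s ^ n) *
            (a (g * t ^ m) * b (h * t ^ n)) := sum_congr rfl fun s _ => sum_comm
        _ = _ := sum_congr rfl fun s _ => sum_congr rfl fun t _ => sum_congr rfl fun g _ =>
            sum_congr rfl fun h _ => by ring
    have e2 : ∀ (F : G → ℝ) (x y : G), ∑ g, F (g * x) * F (g * y) = autocorr F (x⁻¹ * y) := by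
      intro F x y
      rw [autocorr, ← sum_mul_right_eq (fun g => F g * F (g * (x⁻¹ * y))) x]
      refine sum_congr rfl fun g _ => ?_
      rw [mul_assoc g x, mul_inv_cancel_left]
    rw [e1]
    simp only [e2]
    have e3 : ∀ s : G, ∑ t : G, autocorr a ((s ^ m)⁻¹ * t ^ m) * autocorr b ((s ^ n)⁻¹ * t ^ n) =
        ∑ t : G, autocorr a (t ^ m) * autocorr b (t ^ n) := by
      intro s
      rw [← sum_mul_left_eq (fun t => autocorr a (t ^ m) * autocorr b (t ^ n)) s⁻¹]
      exact sum_congr rfl fun t _ => by rw [mul_pow, mul_pow, inv_pow, inv_pow]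
    simp only [e3, sum_const, card_univ, nsmul_eq_mul]
  rw [h3] at h2
  have h4 := sum_mul_sq_le_sq_mul_sq (univ : Finset G) (fun t => autocorr a (t ^ m))
    (fun t => autocorr b (t ^ n))
  have h5 := hGm (fun t => autocorr a t ^ 2) fun _ => sq_nonneg _
  have h6 := hGn (fun t => autocorr b t ^ 2) fun _ => sq_nonneg _
  rw [sum_conv_sq, sum_conv_sq]
  calc T ^ 4 = (T ^ 2) ^ 2 := by ring
    _ ≤ (Fintype.card G * ∑ t : G, autocorr a (t ^ m) * autocorr b (t ^ n)) ^ 2 := by gcongr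
    _ = (Fintype.card G : ℝ) ^ 2 * (∑ t : G, autocorr a (t ^ m) * autocorr b (t ^ n)) ^ 2 := by ring
    _ ≤ (Fintype.card G : ℝ) ^ 2 * ((m * ∑ t, autocorr a t ^ 2) *
          (n * ∑ t, autocorr b t ^ 2)) := by
        gcongr
        refine h4.trans ?_
        gcongr
    _ = _ := by ring

end Convolution

theorem powFiber_units (p : ℕ) [Fact p.Prime] {m : ℕ} (hm : 0 < m) : PowFiber (ZMod p)ˣ m := by
  classical
  intro F hF
  rw [← sum_fiberwise_of_maps_to (s := univ) (t := univ) (g := fun t : (ZMod p)ˣ => t ^ m)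
    (fun _ _ => mem_univ _), mul_sum]
  refine sum_le_sum fun g _ => ?_
  have h1 : ∑ t ∈ univ.filter (fun t : (ZMod p)ˣ => t ^ m = g), F (t ^ m) =
      #(univ.filter (fun t : (ZMod p)ˣ => t ^ m = g)) * F g := by
    rw [← nsmul_eq_mul, ← sum_const]
    exact sum_congr rfl fun t ht => by rw [(mem_filter.1 ht).2]
  rw [h1]
  have h2 : #(univ.filter (fun t : (ZMod p)ˣ => t ^ m = g)) ≤ m := by
    rcases (univ.filter (fun t : (ZMod p)ˣ => t ^ m = g)).eq_empty_or_nonempty with h | ⟨t0, ht0⟩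
    · rw [h]; simp
    · refine le_trans ?_ (IsCyclic.card_pow_eq_one_le (α := (ZMod p)ˣ) hm)
      refine card_le_card_of_injOn (fun t => t * t0⁻¹) ?_ ?_
      · intro t ht
        simp only [coe_filter, mem_univ, true_and, Set.mem_ofPred_eq, mem_filter] at ht ht0 ⊢
        rw [mul_pow, ht, inv_pow, ht0, mul_inv_cancel]
      · intro t _ s _ h
        exact mul_right_cancel h
  exact mul_le_mul_of_nonneg_right (by exact_mod_cast h2) (hF g)

/-- `mulWeight M j n` counts the representations of `n ≠ 0` as a (bracketed) product of `2 ^ j`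
nonzero integers in `[-M, M]`. -/
def mulWeight (M : ℕ) : ℕ → ℤ → ℝ
  | 0 => fun n => if n = 0 then 0 else 1
  | j + 1 => fun n => ∑ a ∈ Icc (-((M ^ 2 ^ j : ℕ) : ℤ)) ((M ^ 2 ^ j : ℕ) : ℤ),
      ∑ b ∈ Icc (-((M ^ 2 ^ j : ℕ) : ℤ)) ((M ^ 2 ^ j : ℕ) : ℤ),
        if a * b = n then mulWeight M j a * mulWeight M j b else 0

theorem mulWeight_nonneg (M j : ℕ) (n : ℤ) : 0 ≤ mulWeight M j n := by
  induction j generalizing n with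
  | zero => simp only [mulWeight]; split_ifs <;> norm_num
  | succ j ih =>
    refine sum_nonneg fun a _ => sum_nonneg fun b _ => ?_
    split_ifs
    · exact mul_nonneg (ih a) (ih b)
    · exact le_rfl

theorem mulWeight_zero_right (M j : ℕ) : mulWeight M j 0 = 0 := by
  induction j with
  | zero => simp [mulWeight]
  | succ j ih =>
    refine sum_eq_zero fun a _ => sum_eq_zero fun b _ => ?_
    split_ifs with h
    · rcases mul_eq_zero.1 h with rfl | rfl <;> simp [ih]
    · rfl

theorem mul_mem_Icc_sq {L : ℕ} {a b : ℤ} (ha : a ∈ Icc (-(L : ℤ)) L) (hb : b ∈ Icc (-(L : ℤ)) L) :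
    a * b ∈ Icc (-((L ^ 2 : ℕ) : ℤ)) ((L ^ 2 : ℕ) : ℤ) := by
  rw [mem_Icc, ← abs_le] at *
  rw [abs_mul]; push_cast
  nlinarith [abs_nonneg a, abs_nonneg b]

theorem sum_mulWeight_succ (M j : ℕ) (φ : ℤ → ℝ) :
    ∑ n ∈ Icc (-((M ^ 2 ^ (j + 1) : ℕ) : ℤ)) ((M ^ 2 ^ (j + 1) : ℕ) : ℤ),
      mulWeight M (j + 1) n * φ n =
    ∑ a ∈ Icc (-((M ^ 2 ^ j : ℕ) : ℤ)) ((M ^ 2 ^ j : ℕ) : ℤ),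
      ∑ b ∈ Icc (-((M ^ 2 ^ j : ℕ) : ℤ)) ((M ^ 2 ^ j : ℕ) : ℤ),
        mulWeight M j a * mulWeight M j b * φ (a * b) := by
  simp only [mulWeight, sum_mul]
  rw [sum_comm]
  refine sum_congr rfl fun a ha => ?_
  rw [sum_comm]
  refine sum_congr rfl fun b hb => ?_
  simp only [ite_mul, zero_mul]
  rw [sum_ite_eq, if_pos]
  rw [pow_succ, pow_mul]
  exact mul_mem_Icc_sq ha hb

theorem iterConv_resSum (p M : ℕ) [Fact p.Prime] (j : ℕ) :
    iterConv (fun g : (ZMod p)ˣ => resSum p M (mulWeight M 0) g) j =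
      fun g : (ZMod p)ˣ => resSum p (M ^ 2 ^ j) (mulWeight M j) g := by
  classical
  induction j with
  | zero => simp [iterConv]
  | succ j ih =>
    funext g
    simp only [iterConv, ih, conv]
    have hr : resSum p (M ^ 2 ^ (j + 1)) (mulWeight M (j + 1)) (g : ZMod p) =
        ∑ n ∈ Icc (-((M ^ 2 ^ (j + 1) : ℕ) : ℤ)) ((M ^ 2 ^ (j + 1) : ℕ) : ℤ),
          mulWeight M (j + 1) n * (if (n : ZMod p) = g then 1 else 0) := by
      simp only [resSum, mul_ite, mul_one, mul_zero]
    rw [hr, sum_mulWeight_succ]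
    simp only [resSum, sum_mul_sum]
    rw [sum_comm]
    refine sum_congr rfl fun a _ => ?_
    rw [sum_comm]
    refine sum_congr rfl fun b _ => ?_
    by_cases hab : ((a * b : ℤ) : ZMod p) = g
    · rw [if_pos hab, mul_one]
      push_cast at hab
      have ha0 : (a : ZMod p) ≠ 0 := by
        intro h; rw [h, zero_mul] at hab; exact g.ne_zero hab.symm
      rw [sum_eq_single (Units.mk0 (a : ZMod p) ha0)]
      · rw [if_pos (Units.val_mk0 ha0).symm, if_pos]
        push_cast
        rw [Units.val_mk0, ← hab, inv_mul_cancel_left₀ ha0]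
      · intro s _ hs
        rw [if_neg, zero_mul]
        intro h
        exact hs (Units.ext (by simpa using h.symm))
      · intro h; exact absurd (mem_univ _) h
    · rw [if_neg hab, mul_zero]
      refine sum_eq_zero fun s _ => ?_
      by_cases h1 : (a : ZMod p) = s
      · by_cases h2 : (b : ZMod p) = ((s⁻¹ * g : (ZMod p)ˣ) : ZMod p)
        · exfalso; apply hab
          push_cast
          rw [h1, h2, ← Units.val_mul, mul_inv_cancel_left]
        · rw [if_neg h2, mul_zero]
      · rw [if_neg h1, zero_mul]

/-- The centred residue counts of `[-M, M]` on the unit group. -/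
def discrepancy (p M : ℕ) [Fact p.Prime] (g : (ZMod p)ˣ) : ℝ :=
  resSum p M (mulWeight M 0) g - mean fun g : (ZMod p)ˣ => resSum p M (mulWeight M 0) g

theorem sum_iterConv_discrepancy_le (p M : ℕ) [Fact p.Prime] (j : ℕ) :
    (Fintype.card (ZMod p)ˣ : ℝ) * ∑ g, iterConv (discrepancy p M) j g ^ 2 ≤
      lsTerm p (M ^ 2 ^ j) (mulWeight M j) := by
  have h1 : discrepancy p M = fun g : (ZMod p)ˣ => (fun g : (ZMod p)ˣ =>
    resSum p M (mulWeight M 0) g) g - mean fun g : (ZMod p)ˣ => resSum p M (mulWeight M 0) g := rfl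
  rw [h1, iterConv_sub_mean, iterConv_resSum]
  refine le_trans ?_ (units_variance_le_lsTerm (p := p) (M ^ 2 ^ j) (mulWeight M j))
  have : (Fintype.card (ZMod p)ˣ : ℝ) ≤ p := by
    rw [ZMod.card_units_eq_totient]; exact_mod_cast Nat.totient_le p
  exact mul_le_mul_of_nonneg_right this (sum_nonneg fun _ _ => by positivity)

/-- The number of positive divisors of an integer, with value `0` at `0`. -/
def numDiv (n : ℤ) : ℕ := #n.natAbs.divisors

theorem numDiv_mul_le (a b : ℤ) : numDiv (a * b) ≤ numDiv a * numDiv b := by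
  unfold numDiv
  rw [Int.natAbs_mul, Nat.divisors_mul]
  exact Finset.card_mul_le

theorem sum_factorizations_le (L : ℕ) {n : ℤ} (hn : n ≠ 0) :
    (∑ a ∈ Icc (-(L : ℤ)) L, ∑ b ∈ Icc (-(L : ℤ)) L, if a * b = n then (1 : ℝ) else 0) ≤
      2 * numDiv n := by
  have h1 : ∀ a ∈ Icc (-(L : ℤ)) L,
      (∑ b ∈ Icc (-(L : ℤ)) L, if a * b = n then (1 : ℝ) else 0) ≤ if a ∣ n then 1 else 0 := by
    intro a _
    split_ifs with h
    · obtain ⟨c, rfl⟩ := h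
      have ha : a ≠ 0 := left_ne_zero_of_mul hn
      simp only [mul_right_inj' ha]
      rw [sum_ite_eq']
      split_ifs <;> norm_num
    · refine (sum_eq_zero fun b _ => ?_).le
      rw [if_neg]
      rintro rfl
      exact h (dvd_mul_right a b)
  refine (sum_le_sum h1).trans ?_
  rw [← sum_filter, sum_const, nsmul_eq_mul, mul_one]
  have h2 : (Icc (-(L : ℤ)) L).filter (· ∣ n) ⊆
      n.natAbs.divisors.image (fun d : ℕ => (d : ℤ)) ∪
        n.natAbs.divisors.image (fun d : ℕ => -(d : ℤ)) := by
    intro a ha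
    rw [mem_filter] at ha
    have hd : a.natAbs ∈ n.natAbs.divisors :=
      Nat.mem_divisors.2 ⟨Int.natAbs_dvd_natAbs.2 ha.2, Int.natAbs_ne_zero.2 hn⟩
    rw [mem_union, mem_image, mem_image]
    rcases Int.natAbs_eq a with h | h
    · exact Or.inl ⟨_, hd, h.symm⟩
    · exact Or.inr ⟨_, hd, h.symm⟩
  have h3 := (card_le_card h2).trans (card_union_le _ _)
  have h4 : #(n.natAbs.divisors.image (fun d : ℕ => (d : ℤ))) ≤ numDiv n := card_image_le
  have h5 : #(n.natAbs.divisors.image (fun d : ℕ => -(d : ℤ))) ≤ numDiv n := card_image_le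
  exact_mod_cast (by omega : _ ≤ 2 * numDiv n)

theorem mulWeight_succ_le (M j : ℕ) (n : ℤ) {c : ℝ} (hc : 0 ≤ c)
    (h : ∀ a ∈ Icc (-((M ^ 2 ^ j : ℕ) : ℤ)) ((M ^ 2 ^ j : ℕ) : ℤ), mulWeight M j a ≤ c) :
    mulWeight M (j + 1) n ≤ c ^ 2 * (2 * numDiv n) := by
  rcases eq_or_ne n 0 with rfl | hn
  · rw [mulWeight_zero_right]; positivity
  refine le_trans ?_ (mul_le_mul_of_nonneg_left (sum_factorizations_le (M ^ 2 ^ j) hn) (sq_nonneg c))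
  simp only [mulWeight, mul_sum]
  refine sum_le_sum fun a ha => sum_le_sum fun b hb => ?_
  split_ifs
  · rw [mul_one, sq]
    exact mul_le_mul (h a ha) (h b hb) (mulWeight_nonneg _ _ _) hc
  · simp

theorem mulWeight_zero_le (M : ℕ) (n : ℤ) : mulWeight M 0 n ≤ 1 := by
  simp only [mulWeight]; split_ifs <;> norm_num

theorem sum_numDiv_le (M : ℕ) :
    ∑ a ∈ Icc (-(M : ℤ)) M, (numDiv a : ℝ) ≤ 2 * (M * (1 + Real.log M)) := by
  have h1 : ∑ a ∈ Icc 1 M, (numDiv (a : ℕ) : ℝ) ≤ M * (1 + Real.log M) := by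
    have e : ∑ a ∈ Icc 1 M, numDiv (a : ℕ) = ∑ d ∈ Icc 1 M, M / d := by
      have hd : ∀ a ∈ Icc 1 M, numDiv (a : ℕ) = ∑ d ∈ Icc 1 M, if d ∣ a then 1 else 0 := by
        intro a ha
        rw [mem_Icc] at ha
        rw [numDiv, Int.natAbs_natCast, ← card_filter]
        congr 1
        ext d
        rw [Nat.mem_divisors, mem_filter, mem_Icc]
        refine ⟨fun h => ⟨⟨Nat.pos_of_dvd_of_pos h.1 ha.1, (Nat.le_of_dvd ha.1 h.1).trans ha.2⟩, h.1⟩,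
          fun h => ⟨h.2, by omega⟩⟩
      rw [sum_congr rfl hd, sum_comm]
      refine sum_congr rfl fun d _ => ?_
      rw [← card_filter, ← Nat.Ioc_filter_dvd_card_eq_div]
      rfl
    have e' : ∑ a ∈ Icc 1 M, (numDiv (a : ℕ) : ℝ) = ∑ d ∈ Icc 1 M, ((M / d : ℕ) : ℝ) := by
      exact_mod_cast e
    rw [e']
    calc ∑ d ∈ Icc 1 M, ((M / d : ℕ) : ℝ) ≤ ∑ d ∈ Icc 1 M, (M : ℝ) * (d : ℝ)⁻¹ :=
          sum_le_sum fun d _ => by rw [← div_eq_mul_inv]; exact Nat.cast_div_le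
      _ = M * (harmonic M : ℝ) := by
          rw [harmonic_eq_sum_Icc, ← mul_sum]; push_cast; rfl
      _ ≤ _ := by gcongr; exact harmonic_le_one_add_log M
  have h2 : Icc (-(M : ℤ)) M ⊆ insert 0 ((Icc 1 M).image (fun a : ℕ => (a : ℤ)) ∪
      (Icc 1 M).image (fun a : ℕ => -(a : ℤ))) := by
    intro a ha
    rw [mem_Icc] at ha
    simp only [mem_insert, mem_union, mem_image, mem_Icc]
    rcases lt_trichotomy a 0 with h | h | h
    · exact Or.inr (Or.inr ⟨a.natAbs, by omega, by omega⟩)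
    · exact Or.inl h
    · exact Or.inr (Or.inl ⟨a.natAbs, by omega, by omega⟩)
  have nn : ∀ a : ℤ, (0 : ℝ) ≤ numDiv a := fun a => Nat.cast_nonneg _
  calc ∑ a ∈ Icc (-(M : ℤ)) M, (numDiv a : ℝ)
      ≤ ∑ a ∈ insert 0 ((Icc 1 M).image (fun a : ℕ => (a : ℤ)) ∪
          (Icc 1 M).image (fun a : ℕ => -(a : ℤ))), (numDiv a : ℝ) :=
        sum_le_sum_of_subset_of_nonneg h2 fun _ _ _ => nn _
    _ ≤ ∑ a ∈ (Icc 1 M).image (fun a : ℕ => (a : ℤ)), (numDiv a : ℝ) +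
          ∑ a ∈ (Icc 1 M).image (fun a : ℕ => -(a : ℤ)), (numDiv a : ℝ) := by
        rw [sum_insert_of_eq_zero_if_notMem (fun _ => by simp [numDiv]), ← sum_union_inter]
        exact le_add_of_nonneg_right (sum_nonneg fun _ _ => nn _)
    _ = ∑ a ∈ Icc 1 M, (numDiv (a : ℕ) : ℝ) + ∑ a ∈ Icc 1 M, (numDiv (a : ℕ) : ℝ) := by
        rw [sum_image (fun a _ b _ h => by simpa using h),
          sum_image (fun a _ b _ h => by simpa using h)]
        simp [numDiv]
    _ ≤ _ := by linarith

theorem sum_mulWeight_one_sq_le (M : ℕ) :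
    ∑ n ∈ Icc (-((M ^ 2 ^ 1 : ℕ) : ℤ)) ((M ^ 2 ^ 1 : ℕ) : ℤ), mulWeight M 1 n ^ 2 ≤
      8 * (M * (1 + Real.log M)) ^ 2 := by
  have h1 : ∀ n, mulWeight M 1 n ≤ 2 * numDiv n := fun n => by
    simpa using mulWeight_succ_le M 0 n zero_le_one fun a _ => mulWeight_zero_le M a
  simp only [sq (mulWeight M 1 _)]
  have := sum_mulWeight_succ M 0 (mulWeight M 1)
  rw [this]
  simp only [pow_zero, pow_one]
  calc _ ≤ ∑ a ∈ Icc (-(M : ℤ)) M, ∑ b ∈ Icc (-(M : ℤ)) M,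
          2 * ((numDiv a : ℝ) * (numDiv b : ℝ)) := by
        refine sum_le_sum fun a _ => sum_le_sum fun b _ => ?_
        have h2 : (numDiv (a * b) : ℝ) ≤ numDiv a * numDiv b := by exact_mod_cast numDiv_mul_le a b
        have h3 : mulWeight M 0 a * mulWeight M 0 b ≤ 1 :=
          mul_le_one₀ (mulWeight_zero_le M a) (mulWeight_nonneg _ _ _) (mulWeight_zero_le M b)
        have h4 := mulWeight_nonneg M 1 (a * b)
        have h5 := h1 (a * b)
        nlinarith
    _ = 2 * (∑ a ∈ Icc (-(M : ℤ)) M, (numDiv a : ℝ)) ^ 2 := by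
        rw [sq, sum_mul_sum]; simp only [mul_sum]
    _ ≤ 2 * (2 * (M * (1 + Real.log M))) ^ 2 := by
        have : 0 ≤ ∑ a ∈ Icc (-(M : ℤ)) M, (numDiv a : ℝ) := sum_nonneg fun _ _ => Nat.cast_nonneg _
        have := sum_numDiv_le M
        gcongr
    _ = _ := by ring

theorem sum_mulWeight_le (M j : ℕ) :
    ∑ n ∈ Icc (-((M ^ 2 ^ j : ℕ) : ℤ)) ((M ^ 2 ^ j : ℕ) : ℤ), mulWeight M j n ≤
      (2 * (M : ℝ)) ^ 2 ^ j := by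
  induction j with
  | zero =>
    simp only [pow_zero, pow_one, mulWeight]
    have : ∀ n : ℤ, (if n = 0 then (0 : ℝ) else 1) = 1 - if n = 0 then 1 else 0 := fun n => by
      split_ifs <;> norm_num
    simp only [this, sum_sub_distrib, sum_const, sum_ite_eq', nsmul_eq_mul, mul_one, Int.card_Icc]
    rw [if_pos (by simp)]
    have h : ((M : ℤ) + 1 - -(M : ℤ)).toNat = 2 * M + 1 := by omega
    rw [h]; push_cast; linarith
  | succ j ih =>
    have := sum_mulWeight_succ M j fun _ => 1
    simp only [mul_one] at this
    rw [this, ← sum_mul_sum, ← sq, show (2 * (M : ℝ)) ^ 2 ^ (j + 1) = ((2 * (M : ℝ)) ^ 2 ^ j) ^ 2 by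
      rw [pow_succ, pow_mul]]
    have h0 : 0 ≤ ∑ n ∈ Icc (-((M ^ 2 ^ j : ℕ) : ℤ)) ((M ^ 2 ^ j : ℕ) : ℤ), mulWeight M j n :=
      sum_nonneg fun _ _ => mulWeight_nonneg _ _ _
    gcongr

theorem exists_card_divisors_le {δ : ℝ} (hδ : 0 < δ) :
    ∃ C : ℝ, 0 < C ∧ ∀ n : ℕ, n ≠ 0 → (#n.divisors : ℝ) ≤ C * (n : ℝ) ^ δ := by
  have hl : 0 < Real.log 2 := Real.log_pos one_lt_two
  set K : ℝ := 1 + 1 / (δ * Real.log 2) with hK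
  have hK1 : 1 ≤ K := by rw [hK]; have : 0 < 1 / (δ * Real.log 2) := by positivity
                         linarith
  set P : ℕ := ⌈(2 : ℝ) ^ (1 / δ)⌉₊ with hP
  refine ⟨K ^ P, by positivity, fun n hn => ?_⟩
  have hfac : ((n : ℝ)) ^ δ = ∏ p ∈ n.primeFactors, (p : ℝ) ^ (δ * n.factorization p) := by
    conv_lhs => rw [← Nat.prod_factorization_pow_eq_self hn]
    rw [Finsupp.prod, Nat.support_factorization]
    push_cast
    rw [← Real.finsetProd_rpow _ _ fun i _ => by positivity]
    refine prod_congr rfl fun p _ => ?_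
    rw [mul_comm, Real.rpow_mul (Nat.cast_nonneg p), Real.rpow_natCast]
  have hloc : ∀ p ∈ n.primeFactors, ((n.factorization p + 1 : ℕ) : ℝ) ≤
      (if p < P then K else 1) * (p : ℝ) ^ (δ * n.factorization p) := by
    intro p hp
    have hp2 : (2 : ℝ) ≤ p := by exact_mod_cast (Nat.prime_of_mem_primeFactors hp).two_le
    set e := n.factorization p
    push_cast
    split_ifs with h
    · have h1 : 1 + δ * e * Real.log 2 ≤ (p : ℝ) ^ (δ * e) := by
        calc 1 + δ * e * Real.log 2 ≤ Real.exp (Real.log 2 * (δ * e)) := by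
              have := Real.add_one_le_exp (Real.log 2 * (δ * e)); linarith
          _ = (2 : ℝ) ^ (δ * e) := by rw [Real.rpow_def_of_pos two_pos]
          _ ≤ _ := Real.rpow_le_rpow two_pos.le hp2 (by positivity)
      have h2 : K * (1 + δ * e * Real.log 2) = 1 + e + (δ * e * Real.log 2 + 1 / (δ * Real.log 2)) := by
        rw [hK]; field_simp; ring
      have h3 : 0 ≤ δ * e * Real.log 2 + 1 / (δ * Real.log 2) := by positivity
      have h4 := mul_le_mul_of_nonneg_left h1 (zero_le_one.trans hK1)
      linarith
    · have h1 : (2 : ℝ) ≤ (p : ℝ) ^ δ := by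
        have h5 : (2 : ℝ) ^ (1 / δ) ≤ p :=
          (Nat.le_ceil _).trans (by exact_mod_cast not_lt.1 h)
        calc (2 : ℝ) = ((2 : ℝ) ^ (1 / δ)) ^ δ := by
              rw [← Real.rpow_mul two_pos.le, one_div_mul_cancel hδ.ne', Real.rpow_one]
          _ ≤ _ := Real.rpow_le_rpow (by positivity) h5 hδ.le
      rw [one_mul, Real.rpow_mul (Nat.cast_nonneg p), Real.rpow_natCast]
      calc (e : ℝ) + 1 ≤ 2 ^ e := by exact_mod_cast Nat.lt_two_pow_self
        _ ≤ _ := pow_le_pow_left₀ two_pos.le h1 e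
  rw [Nat.card_divisors hn, hfac]
  calc ((∏ p ∈ n.primeFactors, (n.factorization p + 1) : ℕ) : ℝ)
      = ∏ p ∈ n.primeFactors, ((n.factorization p + 1 : ℕ) : ℝ) := Nat.cast_prod _ _
    _ ≤ ∏ p ∈ n.primeFactors, (if p < P then K else 1) * (p : ℝ) ^ (δ * n.factorization p) :=
        prod_le_prod (fun _ _ => Nat.cast_nonneg _) hloc
    _ = (∏ p ∈ n.primeFactors, if p < P then K else 1) *
          ∏ p ∈ n.primeFactors, (p : ℝ) ^ (δ * n.factorization p) := prod_mul_distrib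
    _ ≤ _ := by
        refine mul_le_mul_of_nonneg_right (b := ∏ p ∈ n.primeFactors, if p < P then K else 1) ?_
          (prod_nonneg fun _ _ => by positivity)
        rw [prod_ite, prod_const, prod_const_one, mul_one]
        refine pow_le_pow_right₀ hK1 ?_
        calc _ ≤ #(range P) := card_le_card fun p hp => mem_range.2 (mem_filter.1 hp).2
          _ = P := card_range P

theorem exists_mulWeight_le (j : ℕ) {δ : ℝ} (hδ : 0 < δ) :
    ∃ C : ℝ, 0 < C ∧ ∀ M : ℕ, 1 ≤ M → ∀ n ∈ Icc (-((M ^ 2 ^ j : ℕ) : ℤ)) ((M ^ 2 ^ j : ℕ) : ℤ),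
      mulWeight M j n ≤ C * (M : ℝ) ^ δ := by
  induction j generalizing δ with
  | zero =>
    refine ⟨1, one_pos, fun M hM n _ => (mulWeight_zero_le M n).trans ?_⟩
    rw [one_mul]
    exact Real.one_le_rpow (by exact_mod_cast hM) hδ.le
  | succ j ih =>
    obtain ⟨C, hC, h⟩ := ih (δ := δ / 4) (by positivity)
    obtain ⟨D, hD, hdiv⟩ := exists_card_divisors_le (δ := δ / 2 / 2 ^ (j + 1)) (by positivity)
    refine ⟨C ^ 2 * (2 * D), by positivity, fun M hM n hn => ?_⟩
    have hM0 : (0 : ℝ) < M := by exact_mod_cast hM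
    rcases eq_or_ne n 0 with rfl | hn0
    · rw [mulWeight_zero_right]; positivity
    refine (mulWeight_succ_le M j n (by positivity) (h M hM)).trans ?_
    have h1 : (numDiv n : ℝ) ≤ D * (M : ℝ) ^ (δ / 2) := by
      refine (hdiv n.natAbs (Int.natAbs_ne_zero.2 hn0)).trans ?_
      refine mul_le_mul_of_nonneg_left ?_ hD.le
      have h2 : (n.natAbs : ℝ) ≤ (M : ℝ) ^ 2 ^ (j + 1) := by
        rw [mem_Icc] at hn
        have : n.natAbs ≤ M ^ 2 ^ (j + 1) := by omega
        exact_mod_cast this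
      refine (Real.rpow_le_rpow (Nat.cast_nonneg _) h2 (by positivity)).trans_eq ?_
      rw [← Real.rpow_natCast, ← Real.rpow_mul hM0.le]
      congr 1
      push_cast
      field_simp
    have h3 : ((M : ℝ) ^ (δ / 4)) ^ 2 * (M : ℝ) ^ (δ / 2) = (M : ℝ) ^ δ := by
      rw [← Real.rpow_natCast, ← Real.rpow_mul hM0.le, ← Real.rpow_add hM0]
      congr 1; push_cast; ring
    calc (C * (M : ℝ) ^ (δ / 4)) ^ 2 * (2 * numDiv n)
        ≤ (C * (M : ℝ) ^ (δ / 4)) ^ 2 * (2 * (D * (M : ℝ) ^ (δ / 2))) := by gcongr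
      _ = C ^ 2 * (2 * D) * (((M : ℝ) ^ (δ / 4)) ^ 2 * (M : ℝ) ^ (δ / 2)) := by ring
      _ = _ := by rw [h3]

theorem sum_lsTerm_mulWeight_zero_le (Q M : ℕ) (hQ : 0 < Q) :
    ∑ p ∈ (range (Q + 1)).filter Nat.Prime, lsTerm p M (mulWeight M 0) ≤
      12 * (2 * M + (Q : ℝ) ^ 2) * (2 * M) := by
  refine (sum_lsTerm_le Q M hQ _).trans (mul_le_mul_of_nonneg_left ?_ (by positivity))
  have := sum_mulWeight_le M 0
  simp only [pow_zero, pow_one] at this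
  refine le_trans (sum_le_sum fun n _ => ?_) this
  rw [sq]
  exact mul_le_of_le_one_left (mulWeight_nonneg _ _ _) (mulWeight_zero_le M n)

theorem sum_lsTerm_mulWeight_one_le (Q M : ℕ) (hQ : 0 < Q) :
    ∑ p ∈ (range (Q + 1)).filter Nat.Prime, lsTerm p (M ^ 2 ^ 1) (mulWeight M 1) ≤
      12 * (2 * (M : ℝ) ^ 2 + (Q : ℝ) ^ 2) * (8 * (M * (1 + Real.log M)) ^ 2) := by
  have := sum_lsTerm_le Q (M ^ 2 ^ 1) hQ (mulWeight M 1)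
  refine this.trans ?_
  push_cast
  refine mul_le_mul_of_nonneg_left ?_ (by positivity)
  exact_mod_cast sum_mulWeight_one_sq_le M

theorem exists_sum_lsTerm_mulWeight_le (j : ℕ) {δ : ℝ} (hδ : 0 < δ) :
    ∃ C : ℝ, 0 < C ∧ ∀ Q M : ℕ, 0 < Q → 1 ≤ M →
      ∑ p ∈ (range (Q + 1)).filter Nat.Prime, lsTerm p (M ^ 2 ^ j) (mulWeight M j) ≤
        C * ((M : ℝ) ^ 2 ^ j + (Q : ℝ) ^ 2) * ((M : ℝ) ^ 2 ^ j * (M : ℝ) ^ δ) := by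
  obtain ⟨C, hC, h⟩ := exists_mulWeight_le j hδ
  refine ⟨24 * (C * 2 ^ 2 ^ j), by positivity, fun Q M hQ hM => ?_⟩
  refine (sum_lsTerm_le Q (M ^ 2 ^ j) hQ (mulWeight M j)).trans ?_
  have h1 : ∑ n ∈ Icc (-((M ^ 2 ^ j : ℕ) : ℤ)) ((M ^ 2 ^ j : ℕ) : ℤ), mulWeight M j n ^ 2 ≤
      C * (M : ℝ) ^ δ * (2 * (M : ℝ)) ^ 2 ^ j := by
    refine le_trans (sum_le_sum fun n hn => ?_)
      ((mul_sum _ _ _).symm.trans_le (mul_le_mul_of_nonneg_left (sum_mulWeight_le M j)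
        (by positivity)))
    rw [sq]
    exact mul_le_mul_of_nonneg_right (h M hM n hn) (mulWeight_nonneg _ _ _)
  calc _ ≤ 12 * (2 * ((M ^ 2 ^ j : ℕ) : ℝ) + (Q : ℝ) ^ 2) *
        (C * (M : ℝ) ^ δ * (2 * (M : ℝ)) ^ 2 ^ j) := by gcongr
    _ ≤ 12 * (2 * ((M : ℝ) ^ 2 ^ j + (Q : ℝ) ^ 2)) *
        (C * (M : ℝ) ^ δ * (2 * (M : ℝ)) ^ 2 ^ j) := by
        gcongr; push_cast; nlinarith [sq_nonneg (Q : ℝ)]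
    _ = _ := by rw [mul_pow]; ring

theorem resSum_nonneg (p M : ℕ) (g : ZMod p) : 0 ≤ resSum p M (mulWeight M 0) g :=
  sum_nonneg fun n _ => by split_ifs; exacts [mulWeight_nonneg _ _ _, le_rfl]

section BoxSum

variable {p : ℕ} [Fact p.Prime]

theorem card_filter_dvd_Icc_le (p M : ℕ) [Fact p.Prime] :
    (∑ n ∈ Icc (-(M : ℤ)) M, if (n : ZMod p) = 0 then (1 : ℝ) else 0) ≤ (2 * M + 1) / p + 1 := by
  have hp : 0 < p := (Fact.out : p.Prime).pos
  have hp' : (0 : ℝ) < p := by exact_mod_cast hp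
  rw [← sum_filter, sum_const, nsmul_eq_mul, mul_one]
  have h1 : (Icc (-(M : ℤ)) M).filter (fun n : ℤ => (n : ZMod p) = 0) ⊆
      (Icc (-((M / p : ℕ) : ℤ)) ((M / p : ℕ) : ℤ)).image (fun k => (p : ℤ) * k) := by
    intro n hn
    rw [mem_filter, mem_Icc, ZMod.intCast_zmod_eq_zero_iff_dvd] at hn
    obtain ⟨⟨h1, h2⟩, k, rfl⟩ := hn
    refine mem_image.2 ⟨k, mem_Icc.2 ?_, rfl⟩
    have h3 : ((M / p : ℕ) : ℤ) = (M : ℤ) / p := Int.natCast_div M p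
    have hpz : (0 : ℤ) < p := by exact_mod_cast hp
    rw [h3]
    constructor
    · have := (Int.le_ediv_iff_mul_le hpz).2 (show -k * (p : ℤ) ≤ M by linarith)
      linarith
    · exact (Int.le_ediv_iff_mul_le hpz).2 (by linarith)
  have h2 := (card_le_card h1).trans card_image_le
  rw [Int.card_Icc] at h2
  have h3 : #((Icc (-(M : ℤ)) M).filter (fun n : ℤ => (n : ZMod p) = 0)) ≤ 2 * (M / p) + 1 := by omega
  have h4 : ((M / p : ℕ) : ℝ) ≤ M / p := Nat.cast_div_le
  calc _ ≤ ((2 * (M / p) + 1 : ℕ) : ℝ) := by exact_mod_cast h3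
    _ ≤ 2 * (M / p) + 1 := by push_cast; linarith
    _ ≤ _ := by rw [add_div, mul_div_assoc]; have : 0 ≤ 1 / (p : ℝ) := by positivity
                linarith

theorem sum_Icc_one (M : ℕ) : (∑ _n ∈ Icc (-(M : ℤ)) M, (1 : ℝ)) = 2 * M + 1 := by
  rw [sum_const, Int.card_Icc, nsmul_eq_mul, mul_one]
  have h : ((M : ℤ) + 1 - -(M : ℤ)).toNat = 2 * M + 1 := by omega
  rw [h]; push_cast; ring

theorem resSum_zero_unit (M : ℕ) (g : (ZMod p)ˣ) :
    resSum p M (mulWeight M 0) g =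
      ∑ n ∈ Icc (-(M : ℤ)) M, if (n : ZMod p) = g then (1 : ℝ) else 0 := by
  refine sum_congr rfl fun n _ => ?_
  split_ifs with h
  · simp only [mulWeight]
    rw [if_neg]
    rintro rfl
    exact g.ne_zero (by simpa using h.symm)
  · rfl

theorem sum_units_ite (x : ZMod p) (φ : ZMod p → ℝ) :
    (∑ g : (ZMod p)ˣ, if x = g then φ g else 0) = if x = 0 then 0 else φ x := by
  split_ifs with h
  · refine sum_eq_zero fun g _ => if_neg ?_
    rw [h]; exact g.ne_zero.symm
  · rw [sum_eq_single (Units.mk0 x h)]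
    · simp
    · intro g _ hg
      rw [if_neg]
      intro e
      exact hg (Units.ext (by simpa using e.symm))
    · intro h; exact absurd (mem_univ _) h

theorem sum_resSum_units (M : ℕ) :
    ∑ g : (ZMod p)ˣ, resSum p M (mulWeight M 0) g =
      2 * M + 1 - ∑ n ∈ Icc (-(M : ℤ)) M, if (n : ZMod p) = 0 then (1 : ℝ) else 0 := by
  simp only [resSum_zero_unit]
  rw [sum_comm, ← sum_Icc_one, ← sum_sub_distrib]
  refine sum_congr rfl fun n _ => ?_
  rw [sum_units_ite (n : ZMod p) fun _ => 1]
  split_ifs <;> norm_num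

theorem sum_resSum_units_le (M : ℕ) :
    ∑ g : (ZMod p)ˣ, resSum p M (mulWeight M 0) g ≤ 2 * M + 1 := by
  rw [sum_resSum_units, sub_le_self_iff]
  exact sum_nonneg fun _ _ => by split_ifs <;> norm_num

theorem sum_abs_discrepancy_le (M : ℕ) :
    ∑ g : (ZMod p)ˣ, |discrepancy p M g| ≤ 2 * (2 * M + 1) := by
  have hc : (0 : ℝ) < Fintype.card (ZMod p)ˣ := card_pos_real
  have h0 : 0 ≤ ∑ g : (ZMod p)ˣ, resSum p M (mulWeight M 0) g :=
    sum_nonneg fun _ _ => resSum_nonneg _ _ _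
  calc ∑ g : (ZMod p)ˣ, |discrepancy p M g|
      ≤ ∑ g : (ZMod p)ˣ, (resSum p M (mulWeight M 0) g +
          mean fun g : (ZMod p)ˣ => resSum p M (mulWeight M 0) g) := by
        refine sum_le_sum fun g _ => (abs_sub _ _).trans_eq ?_
        rw [abs_of_nonneg (resSum_nonneg _ _ _), abs_of_nonneg]
        exact div_nonneg h0 hc.le
    _ = 2 * ∑ g : (ZMod p)ˣ, resSum p M (mulWeight M 0) g := by
        rw [sum_add_distrib, sum_const, card_univ, nsmul_eq_mul, mean]
        field_simp; ring
    _ ≤ _ := mul_le_mul_of_nonneg_left (sum_resSum_units_le M) two_pos.le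

theorem sq_sum_abs_discrepancy_le (M : ℕ) :
    (∑ g : (ZMod p)ˣ, |discrepancy p M g|) ^ 2 ≤ lsTerm p M (mulWeight M 0) := by
  have h := sum_iterConv_discrepancy_le p M 0
  simp only [iterConv, pow_zero, pow_one] at h
  refine le_trans ?_ h
  have := sq_sum_le_card_mul_sum_sq (s := (univ : Finset (ZMod p)ˣ)) (f := fun g => |discrepancy p M g|)
  simpa [sq_abs] using this

/-- The sum over a box of a function of the residues, split off the residues divisible by `p`. -/
theorem box_sum_sub_units (f : ZMod p → ZMod p → ℝ) (hf0 : ∀ a b, 0 ≤ f a b)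
    (hf1 : ∀ a b, f a b ≤ 1) (M M' : ℕ) :
    |(∑ a ∈ Icc (-(M : ℤ)) M, ∑ b ∈ Icc (-(M' : ℤ)) M', f a b) -
      ∑ g : (ZMod p)ˣ, ∑ k : (ZMod p)ˣ, f g k *
        (resSum p M (mulWeight M 0) g * resSum p M' (mulWeight M' 0) k)| ≤
      ((2 * M + 1) / p + 1) * (2 * M' + 1) + (2 * M + 1) * ((2 * M' + 1) / p + 1) := by
  have e : ∑ g : (ZMod p)ˣ, ∑ k : (ZMod p)ˣ, f g k *
        (resSum p M (mulWeight M 0) g * resSum p M' (mulWeight M' 0) k) =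
      ∑ a ∈ Icc (-(M : ℤ)) M, ∑ b ∈ Icc (-(M' : ℤ)) M',
        if (a : ZMod p) = 0 then 0 else if (b : ZMod p) = 0 then 0 else f a b := by
    calc _ = ∑ g : (ZMod p)ˣ, ∑ k : (ZMod p)ˣ, ∑ a ∈ Icc (-(M : ℤ)) M, ∑ b ∈ Icc (-(M' : ℤ)) M',
          if (a : ZMod p) = g then (if (b : ZMod p) = k then f g k else 0) else 0 := by
          refine sum_congr rfl fun g _ => sum_congr rfl fun k _ => ?_
          rw [resSum_zero_unit, resSum_zero_unit, sum_mul_sum, mul_sum]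
          refine sum_congr rfl fun a _ => ?_
          rw [mul_sum]
          refine sum_congr rfl fun b _ => ?_
          split_ifs <;> simp
      _ = ∑ a ∈ Icc (-(M : ℤ)) M, ∑ b ∈ Icc (-(M' : ℤ)) M', ∑ g : (ZMod p)ˣ, ∑ k : (ZMod p)ˣ,
          if (a : ZMod p) = g then (if (b : ZMod p) = k then f g k else 0) else 0 := by
          simp only [sum_comm (s := (univ : Finset (ZMod p)ˣ)) (t := Icc _ _)]
      _ = _ := by
          refine sum_congr rfl fun a _ => sum_congr rfl fun b _ => ?_
          rw [← sum_units_ite (a : ZMod p) fun a => if (b : ZMod p) = 0 then 0 else f a b]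
          refine sum_congr rfl fun g _ => ?_
          split_ifs with h
          · rw [sum_units_ite (b : ZMod p) fun b => f g b, if_pos ‹_›]
          · rw [sum_units_ite (b : ZMod p) fun b => f g b, if_neg ‹_›]
          · exact sum_const_zero
  rw [e, ← sum_sub_distrib]
  simp only [← sum_sub_distrib]
  have key : ∀ a b : ℤ, |f a b - (if (a : ZMod p) = 0 then 0 else
      if (b : ZMod p) = 0 then 0 else f a b)| ≤
      (if (a : ZMod p) = 0 then 1 else 0) * 1 + 1 * (if (b : ZMod p) = 0 then 1 else 0) := by
    intro a b
    have h0 := hf0 a b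
    have h1 := hf1 a b
    split_ifs <;> simp only [sub_zero, sub_self, abs_zero, abs_of_nonneg h0] <;> linarith
  calc _ ≤ ∑ a ∈ Icc (-(M : ℤ)) M, ∑ b ∈ Icc (-(M' : ℤ)) M',
        ((if (a : ZMod p) = 0 then (1 : ℝ) else 0) * 1 +
          1 * (if (b : ZMod p) = 0 then 1 else 0)) := by
        refine (abs_sum_le_sum_abs _ _).trans (sum_le_sum fun a _ => ?_)
        exact (abs_sum_le_sum_abs _ _).trans (sum_le_sum fun b _ => key a b)
    _ = (∑ a ∈ Icc (-(M : ℤ)) M, if (a : ZMod p) = 0 then (1 : ℝ) else 0) * (2 * M' + 1) +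
          (2 * M + 1) * ∑ b ∈ Icc (-(M' : ℤ)) M', if (b : ZMod p) = 0 then (1 : ℝ) else 0 := by
        simp only [sum_add_distrib]
        rw [← sum_Icc_one, ← sum_Icc_one, sum_mul_sum, sum_mul_sum]
    _ ≤ _ := by
        gcongr
        · exact card_filter_dvd_Icc_le p M
        · exact card_filter_dvd_Icc_le p M'

theorem sum_sub_sum_units (f : ZMod p → ZMod p → ℝ) (hf0 : ∀ a b, 0 ≤ f a b)
    (hf1 : ∀ a b, f a b ≤ 1) :
    |(∑ a, ∑ b, f a b) - ∑ g : (ZMod p)ˣ, ∑ k : (ZMod p)ˣ, f g k| ≤ 2 * p := by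
  have hu : ∀ φ : ZMod p → ℝ, ∑ a, φ a = φ 0 + ∑ g : (ZMod p)ˣ, φ g := by
    intro φ
    have h1 : ∑ g : (ZMod p)ˣ, φ g = ∑ a : ZMod p, if a = 0 then 0 else φ a := by
      calc _ = ∑ g : (ZMod p)ˣ, ∑ a : ZMod p, if a = g then φ g else 0 := by simp
        _ = _ := by rw [sum_comm]; exact sum_congr rfl fun a _ => sum_units_ite a φ
    have h2 : φ 0 = ∑ a : ZMod p, if a = 0 then φ a else 0 := by simp
    rw [h1, h2, ← sum_add_distrib]
    exact sum_congr rfl fun a _ => by split_ifs <;> simp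
  have hcard : (Fintype.card (ZMod p)ˣ : ℝ) ≤ p := by
    rw [ZMod.card_units_eq_totient]; exact_mod_cast Nat.totient_le p
  rw [hu]
  simp only [fun g : ZMod p => hu (f g)]
  rw [sum_add_distrib]
  have h1 : ∑ b, f 0 b ≤ p := by
    calc ∑ b, f 0 b ≤ ∑ _b : ZMod p, (1 : ℝ) := sum_le_sum fun b _ => hf1 _ _
      _ = p := by simp [ZMod.card]
  have h2 : ∑ g : (ZMod p)ˣ, f g 0 ≤ p := by
    calc ∑ g : (ZMod p)ˣ, f g 0 ≤ ∑ _g : (ZMod p)ˣ, (1 : ℝ) := sum_le_sum fun b _ => hf1 _ _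
      _ ≤ p := by simpa using hcard
  have h3 : 0 ≤ ∑ b, f 0 b := sum_nonneg fun _ _ => hf0 _ _
  have h4 : 0 ≤ ∑ g : (ZMod p)ˣ, f g 0 := sum_nonneg fun _ _ => hf0 _ _
  rw [hu] at h1 h3
  rw [abs_le]
  constructor <;> linarith

theorem abs_sub_main_le {p m NA NB zA zB S Sf F cA cB X Y T : ℝ} (hp2 : 2 ≤ p) (hm : m = p - 1)
    (hNA : 0 < NA) (hNB : 0 < NB) (hcA : cA * m = NA - zA) (hcB : cB * m = NB - zB)
    (hcA0 : 0 ≤ cA) (hcB0 : 0 ≤ cB) (hzA0 : 0 ≤ zA) (hzB0 : 0 ≤ zB) (hzA1 : zA ≤ NA / p + 1)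
    (hzB1 : zB ≤ NB / p + 1) (hS0 : 0 ≤ S) (hS1 : S ≤ m * m)
    (b1 : |F - (cA * cB * S + cB * m * X + cA * m * Y + T)| ≤
      (NA / p + 1) * NB + NA * (NB / p + 1)) (b2 : |Sf - S| ≤ 2 * p) :
    |F - NA * NB * (Sf / (p * m))| ≤ NA * NB * (9 / p + 2 / NA + 2 / NB +
      |X| / NA + |Y| / NB + |T| / (NA * NB)) := by
  have hm0 : 0 < m := by linarith
  have hp0 : 0 < p := by linarith
  have b3 : |cA * cB * S - NA * NB * (S / (m * m))| ≤ zA * NB + NA * zB := by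
    have e : cA * cB * S - NA * NB * (S / (m * m)) =
        ((NA - zA) * (NB - zB) - NA * NB) * (S / (m * m)) := by
      rw [← hcA, ← hcB]; field_simp
    have h01 : |S / (m * m)| ≤ 1 := by
      rw [abs_of_nonneg (by positivity)]; exact (div_le_one (by positivity)).2 hS1
    have hA : zA ≤ NA := by nlinarith
    have hB : zB ≤ NB := by nlinarith
    rw [e, abs_mul]
    refine (mul_le_of_le_one_right (abs_nonneg _) h01).trans ?_
    rw [abs_le]
    constructor <;> nlinarith [mul_nonneg hzA0 hzB0, mul_nonneg hzA0 (sub_nonneg.2 hB),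
      mul_nonneg hzB0 hNA.le, mul_nonneg hzA0 hNB.le]
  have b4 : |NA * NB * (S / (m * m)) - NA * NB * (S / (p * m))| ≤ NA * NB / p := by
    have e : NA * NB * (S / (m * m)) - NA * NB * (S / (p * m)) =
        NA * NB / p * (S / (m * m)) := by
      field_simp; rw [hm]; ring
    rw [e, abs_of_nonneg (by positivity)]
    exact mul_le_of_le_one_right (by positivity) ((div_le_one (by positivity)).2 hS1)
  have b5 : |NA * NB * (S / (p * m)) - NA * NB * (Sf / (p * m))| ≤ NA * NB * (4 / p) := by
    rw [← mul_sub, ← sub_div, abs_mul, abs_div, abs_of_pos (mul_pos hNA hNB),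
      abs_of_pos (mul_pos hp0 hm0), abs_sub_comm]
    refine mul_le_mul_of_nonneg_left ?_ (by positivity)
    rw [div_le_div_iff₀ (by positivity) hp0]
    have : (p : ℝ) ≤ 2 * m := by linarith
    nlinarith
  have b6 : |cB * m * X| ≤ NB * |X| := by
    rw [abs_mul, abs_of_nonneg (by positivity)]
    exact mul_le_mul_of_nonneg_right (by linarith) (abs_nonneg _)
  have b7 : |cA * m * Y| ≤ NA * |Y| := by
    rw [abs_mul, abs_of_nonneg (by positivity)]
    exact mul_le_mul_of_nonneg_right (by linarith) (abs_nonneg _)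
  have b8 : zA * NB + NA * zB ≤ (NA / p + 1) * NB + NA * (NB / p + 1) := by gcongr
  have e9 : NA * NB * (9 / p + 2 / NA + 2 / NB + |X| / NA + |Y| / NB + |T| / (NA * NB)) =
      2 * ((NA / p + 1) * NB + NA * (NB / p + 1)) + NA * NB / p + NA * NB * (4 / p) +
        NB * |X| + NA * |Y| + |T| := by
    field_simp; ring
  rw [e9]
  rw [abs_le] at b1 b3 b4 b5 b6 b7 ⊢
  have hT1 := le_abs_self T
  have hT2 := neg_abs_le T
  constructor <;> linarith

set_option maxHeartbeats 400000 in
/-- A twist-invariant set of pairs of residues is equidistributed in a box, up to error terms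
controlled by the large sieve. -/
theorem exists_box_sum_approx (f : ZMod p → ZMod p → ℝ) (hf0 : ∀ a b, 0 ≤ f a b)
    (hf1 : ∀ a b, f a b ≤ 1)
    (hinv : ∀ a b (t : (ZMod p)ˣ), f (a * (t : ZMod p) ^ 4) (b * (t : ZMod p) ^ 6) = f a b)
    (M M' : ℕ) :
    ∃ X Y T : ℝ,
      |(∑ a ∈ Icc (-(M : ℤ)) M, ∑ b ∈ Icc (-(M' : ℤ)) M', f a b) -
        (2 * M + 1) * (2 * M' + 1) * ((∑ a, ∑ b, f a b) / ((p : ℝ) * (p - 1)))| ≤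
        (2 * M + 1) * (2 * M' + 1) * (9 / p + 2 / (2 * M + 1) + 2 / (2 * M' + 1) +
          |X| / (2 * M + 1) + |Y| / (2 * M' + 1) + |T| / ((2 * M + 1) * (2 * M' + 1))) ∧
      (∀ j : ℕ, 4 * (X ^ 2 / 4) ^ 2 ^ j ≤ lsTerm p (M ^ 2 ^ j) (mulWeight M j)) ∧
      (∀ j : ℕ, 6 * (Y ^ 2 / 6) ^ 2 ^ j ≤ lsTerm p (M' ^ 2 ^ j) (mulWeight M' j)) ∧
      T ^ 4 ≤ 24 * lsTerm p (M ^ 2 ^ 1) (mulWeight M 1) *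
        lsTerm p (M' ^ 2 ^ 1) (mulWeight M' 1) ∧
      T ^ 2 ≤ lsTerm p M (mulWeight M 0) * (2 * (2 * M' + 1)) ^ 2 ∧
      T ^ 2 ≤ lsTerm p M' (mulWeight M' 0) * (2 * (2 * M + 1)) ^ 2 := by
  have hp2 : (2 : ℝ) ≤ p := by exact_mod_cast (Fact.out : p.Prime).two_le
  have hcard : (Fintype.card (ZMod p)ˣ : ℝ) = p - 1 := by
    rw [ZMod.card_units_eq_totient, Nat.totient_prime Fact.out,
      Nat.cast_sub (Fact.out : p.Prime).one_le, Nat.cast_one]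
  set m : ℝ := (p : ℝ) - 1 with hm
  have hm0 : 0 < m := by linarith
  set u : (ZMod p)ˣ → ℝ := fun g => resSum p M (mulWeight M 0) g with hu
  set v : (ZMod p)ˣ → ℝ := fun g => resSum p M' (mulWeight M' 0) g with hv
  have hfabs : ∀ a b, |f a b| ≤ 1 := fun a b => by rw [abs_of_nonneg (hf0 a b)]; exact hf1 a b
  have hinvu : ∀ g k t : (ZMod p)ˣ, f ((g * t ^ 4 : (ZMod p)ˣ) : ZMod p)
      ((k * t ^ 6 : (ZMod p)ˣ) : ZMod p) = f g k := fun g k t => by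
    push_cast; exact hinv g k t
  set X : ℝ := ∑ g : (ZMod p)ˣ, (∑ k : (ZMod p)ˣ, f g k) / m * discrepancy p M g with hX
  set Y : ℝ := ∑ k : (ZMod p)ˣ, (∑ g : (ZMod p)ˣ, f g k) / m * discrepancy p M' k with hY
  set T : ℝ := ∑ g : (ZMod p)ˣ, ∑ k : (ZMod p)ˣ, f g k * (discrepancy p M g * discrepancy p M' k)
    with hT
  have hTle : |T| ≤ (∑ g, |discrepancy p M g|) * ∑ k, |discrepancy p M' k| := by
    rw [sum_mul_sum]
    refine (abs_sum_le_sum_abs _ _).trans (sum_le_sum fun g _ => ?_)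
    refine (abs_sum_le_sum_abs _ _).trans (sum_le_sum fun k _ => ?_)
    rw [abs_mul, abs_mul]
    exact mul_le_of_le_one_left (by positivity) (hfabs _ _)
  have hD : ∀ M : ℕ, 0 ≤ ∑ g : (ZMod p)ˣ, |discrepancy p M g| :=
    fun M => sum_nonneg fun _ _ => abs_nonneg _
  have hTsq : T ^ 2 ≤ (∑ g, |discrepancy p M g|) ^ 2 * (∑ k, |discrepancy p M' k|) ^ 2 := by
    rw [← sq_abs, ← mul_pow]
    exact pow_le_pow_left₀ (abs_nonneg _) hTle 2
  refine ⟨X, Y, T, ?_, fun j => ?_, fun j => ?_, ?_, ?_, ?_⟩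
  · set cA := mean u
    set cB := mean v
    set S := ∑ g : (ZMod p)ˣ, ∑ k : (ZMod p)ˣ, f g k with hS
    set zA : ℝ := ∑ n ∈ Icc (-(M : ℤ)) M, if (n : ZMod p) = 0 then (1 : ℝ) else 0 with hzA
    set zB : ℝ := ∑ n ∈ Icc (-(M' : ℤ)) M', if (n : ZMod p) = 0 then (1 : ℝ) else 0 with hzB
    have hcA : cA * m = 2 * M + 1 - zA := by
      change (∑ g, u g) / Fintype.card (ZMod p)ˣ * m = _
      rw [hcard, div_mul_cancel₀ _ hm0.ne']; exact sum_resSum_units M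
    have hcB : cB * m = 2 * M' + 1 - zB := by
      change (∑ g, v g) / Fintype.card (ZMod p)ˣ * m = _
      rw [hcard, div_mul_cancel₀ _ hm0.ne']; exact sum_resSum_units M'
    have hzA0 : 0 ≤ zA := sum_nonneg fun _ _ => by split_ifs <;> norm_num
    have hzB0 : 0 ≤ zB := sum_nonneg fun _ _ => by split_ifs <;> norm_num
    have hcA0 : 0 ≤ cA := div_nonneg (sum_nonneg fun _ _ => resSum_nonneg _ _ _) (Nat.cast_nonneg _)
    have hcB0 : 0 ≤ cB := div_nonneg (sum_nonneg fun _ _ => resSum_nonneg _ _ _) (Nat.cast_nonneg _)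
    have hzA1 : zA ≤ (2 * M + 1) / p + 1 := card_filter_dvd_Icc_le p M
    have hzB1 : zB ≤ (2 * M' + 1) / p + 1 := card_filter_dvd_Icc_le p M'
    have hdec : ∑ g : (ZMod p)ˣ, ∑ k : (ZMod p)ˣ, f g k * (u g * v k) =
        cA * cB * S + cB * m * X + cA * m * Y + T := by
      have e1 : ∀ g k : (ZMod p)ˣ, f g k * (u g * v k) = cA * cB * f g k +
          cB * m * (f g k / m * discrepancy p M g) + cA * m * (f g k / m * discrepancy p M' k) +
          f g k * (discrepancy p M g * discrepancy p M' k) := by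
        intro g k
        have e2 : u g = cA + discrepancy p M g := by simp only [discrepancy]; ring
        have e3 : v k = cB + discrepancy p M' k := by simp only [discrepancy]; ring
        rw [e2, e3]; field_simp; ring
      have eX : X = ∑ g : (ZMod p)ˣ, ∑ k : (ZMod p)ˣ, f g k / m * discrepancy p M g := by
        rw [hX]; exact sum_congr rfl fun g _ => by rw [sum_div, sum_mul]
      have eY : Y = ∑ g : (ZMod p)ˣ, ∑ k : (ZMod p)ˣ, f g k / m * discrepancy p M' k := by
        rw [hY, sum_comm]; exact sum_congr rfl fun g _ => by rw [sum_div, sum_mul]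
      rw [eX, eY, hS, hT]
      simp only [e1, sum_add_distrib, mul_sum]
    have hS0 : 0 ≤ S := sum_nonneg fun _ _ => sum_nonneg fun _ _ => hf0 _ _
    have hS1 : S ≤ m * m := by
      calc S ≤ ∑ _g : (ZMod p)ˣ, ∑ _k : (ZMod p)ˣ, (1 : ℝ) :=
            sum_le_sum fun g _ => sum_le_sum fun k _ => hf1 _ _
        _ = m * m := by simp only [sum_const, card_univ, nsmul_eq_mul, mul_one, hcard]
    have b1 := box_sum_sub_units f hf0 hf1 M M'
    rw [show (∑ g : (ZMod p)ˣ, ∑ k : (ZMod p)ˣ, f g k * (resSum p M (mulWeight M 0) g *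
      resSum p M' (mulWeight M' 0) k)) = _ from hdec] at b1
    have b2 := sum_sub_sum_units f hf0 hf1
    exact abs_sub_main_le hp2 rfl (by positivity) (by positivity) hcA hcB hcA0 hcB0 hzA0 hzB0 hzA1 hzB1
      hS0 hS1 b1 b2
  · refine le_trans ?_ (sum_iterConv_discrepancy_le p M j)
    have := amplification (m := 4) (by norm_num) (powFiber_units p (by norm_num)) (discrepancy p M)
      (fun g : (ZMod p)ˣ => (∑ k : (ZMod p)ˣ, f g k) / m) (fun g => ?_) (fun g t => ?_) j
    · exact_mod_cast this
    · rw [abs_div, abs_of_pos hm0]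
      refine (div_le_one hm0).2 ((abs_sum_le_sum_abs _ _).trans ?_)
      calc ∑ k : (ZMod p)ˣ, |f g k| ≤ ∑ _k : (ZMod p)ˣ, (1 : ℝ) := sum_le_sum fun k _ => hfabs _ _
        _ = m := by simp only [sum_const, card_univ, nsmul_eq_mul, mul_one, hcard]
    · rw [← sum_mul_right_eq (fun k : (ZMod p)ˣ => f ((g * t ^ 4 : (ZMod p)ˣ) : ZMod p) k) (t ^ 6)]
      simp only [hinvu]
  · refine le_trans ?_ (sum_iterConv_discrepancy_le p M' j)
    have := amplification (m := 6) (by norm_num) (powFiber_units p (by norm_num)) (discrepancy p M')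
      (fun k : (ZMod p)ˣ => (∑ g : (ZMod p)ˣ, f g k) / m) (fun k => ?_) (fun k t => ?_) j
    · exact_mod_cast this
    · rw [abs_div, abs_of_pos hm0]
      refine (div_le_one hm0).2 ((abs_sum_le_sum_abs _ _).trans ?_)
      calc ∑ g : (ZMod p)ˣ, |f g k| ≤ ∑ _k : (ZMod p)ˣ, (1 : ℝ) := sum_le_sum fun k _ => hfabs _ _
        _ = m := by simp only [sum_const, card_univ, nsmul_eq_mul, mul_one, hcard]
    · rw [← sum_mul_right_eq (fun g : (ZMod p)ˣ => f g ((k * t ^ 6 : (ZMod p)ˣ) : ZMod p)) (t ^ 4)]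
      simp only [hinvu]
  · have h := bilinear_bound (powFiber_units p (m := 4) (by norm_num))
      (powFiber_units p (m := 6) (by norm_num)) (fun g k : (ZMod p)ˣ => f g k)
      (fun g k => hfabs _ _) hinvu (discrepancy p M) (discrepancy p M')
    refine h.trans ?_
    have h1 := sum_iterConv_discrepancy_le p M 1
    have h2 := sum_iterConv_discrepancy_le p M' 1
    simp only [iterConv] at h1 h2
    have h3 : 0 ≤ lsTerm p (M ^ 2 ^ 1) (mulWeight M 1) := lsTerm_nonneg _ _ _
    calc _ ≤ ((4 : ℕ) : ℝ) * ((6 : ℕ) : ℝ) * lsTerm p (M ^ 2 ^ 1) (mulWeight M 1) *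
          lsTerm p (M' ^ 2 ^ 1) (mulWeight M' 1) := by gcongr
      _ = _ := by norm_num
  · exact hTsq.trans (mul_le_mul (sq_sum_abs_discrepancy_le M)
      (pow_le_pow_left₀ (hD M') (sum_abs_discrepancy_le M') 2) (sq_nonneg _) (lsTerm_nonneg _ _ _))
  · rw [mul_comm] at hTsq
    exact hTsq.trans (mul_le_mul (sq_sum_abs_discrepancy_le M')
      (pow_le_pow_left₀ (hD M) (sum_abs_discrepancy_le M) 2) (sq_nonneg _) (lsTerm_nonneg _ _ _))

end BoxSum

section Twist

variable {p : ℕ}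

theorem affPts_twist (a b : ZMod p) (t : (ZMod p)ˣ) :
    affPts p (a * (t : ZMod p) ^ 4) (b * (t : ZMod p) ^ 6) = affPts p a b := by
  symm
  have key : ∀ x y : ZMod p, y ^ 2 = x ^ 3 + a * x + b ↔
      (((t ^ 3 : (ZMod p)ˣ) : ZMod p) * y) ^ 2 = (((t ^ 2 : (ZMod p)ˣ) : ZMod p) * x) ^ 3 +
        a * (t : ZMod p) ^ 4 * (((t ^ 2 : (ZMod p)ˣ) : ZMod p) * x) + b * (t : ZMod p) ^ 6 := by
    intro x y
    rw [← (t ^ 6).mul_right_inj]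
    push_cast
    ring_nf
  exact Nat.card_congr (Equiv.subtypeEquiv
    ((t ^ 2).mulLeft.prodCongr (t ^ 3).mulLeft) fun xy => key xy.1 xy.2)

theorem apE_twist (a b : ZMod p) (t : (ZMod p)ˣ) :
    apE p (a * (t : ZMod p) ^ 4) (b * (t : ZMod p) ^ 6) = apE p a b := by
  simp only [apE, affPts_twist]

open Classical in
/-- The indicator of the nonsingular curves over `ZMod p` with `a_p² - 4p ∈ Δ(r, h)`. -/
def goodInd (r : ℤ) (h p : ℕ) (a b : ZMod p) : ℝ :=
  if 4 * a ^ 3 + 27 * b ^ 2 ≠ 0 ∧ (apE p a b) ^ 2 - 4 * (p : ℤ) ∈ DeltaSet r h then 1 else 0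

theorem goodInd_nonneg (r : ℤ) (h : ℕ) (a b : ZMod p) : 0 ≤ goodInd r h p a b := by
  unfold goodInd; split_ifs <;> norm_num

theorem goodInd_le_one (r : ℤ) (h : ℕ) (a b : ZMod p) : goodInd r h p a b ≤ 1 := by
  unfold goodInd; split_ifs <;> norm_num

open Classical in
theorem goodInd_twist (r : ℤ) (h : ℕ) (a b : ZMod p) (t : (ZMod p)ˣ) :
    goodInd r h p (a * (t : ZMod p) ^ 4) (b * (t : ZMod p) ^ 6) = goodInd r h p a b := by
  unfold goodInd
  rw [apE_twist]
  have e : 4 * (a * (t : ZMod p) ^ 4) ^ 3 + 27 * (b * (t : ZMod p) ^ 6) ^ 2 =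
      ((t ^ 12 : (ZMod p)ˣ) : ZMod p) * (4 * a ^ 3 + 27 * b ^ 2) := by
    push_cast; ring
  have e' : 4 * (a * (t : ZMod p) ^ 4) ^ 3 + 27 * (b * (t : ZMod p) ^ 6) ^ 2 ≠ 0 ↔
      4 * a ^ 3 + 27 * b ^ 2 ≠ 0 := by
    rw [e]; exact (Units.mul_right_eq_zero _).not
  exact if_congr (and_congr_left' e') rfl rfl

theorem PiFp_eq_sum (r : ℤ) (h p : ℕ) [NeZero p] :
    (PiFp r h p : ℝ) = ∑ a, ∑ b, goodInd r h p a b := by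
  classical
  rw [PiFp, Nat.card_eq_fintype_card, Fintype.card_subtype, ← Fintype.sum_prod_type',
    card_filter]
  push_cast
  exact sum_congr rfl fun _ _ => by unfold goodInd; congr

theorem PiQb_eq_sum (r : ℤ) (h : ℕ) (a b : ℤ) {x : ℝ} (hx : 0 ≤ x) :
    (PiQb r h a b x : ℝ) = ∑ p ∈ (range (⌊x⌋₊ + 1)).filter (fun p => p.Prime ∧ Odd p),
      goodInd r h p (a : ZMod p) (b : ZMod p) := by
  classical
  have e : PiQb r h a b x = #(((range (⌊x⌋₊ + 1)).filter (fun p => p.Prime ∧ Odd p)).filter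
      fun p => 4 * (a : ZMod p) ^ 3 + 27 * (b : ZMod p) ^ 2 ≠ 0 ∧
        (apE p (a : ZMod p) (b : ZMod p)) ^ 2 - 4 * (p : ℤ) ∈ DeltaSet r h) := by
    rw [PiQb]
    refine Nat.subtype_card _ fun p => ?_
    have hdvd : 4 * (a : ZMod p) ^ 3 + 27 * (b : ZMod p) ^ 2 ≠ 0 ↔
        ¬ (p : ℤ) ∣ 4 * a ^ 3 + 27 * b ^ 2 := by
      rw [← ZMod.intCast_zmod_eq_zero_iff_dvd]; push_cast; rfl
    rw [mem_filter, mem_filter, mem_range, hdvd, Nat.lt_succ_iff, Nat.le_floor_iff hx]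
    constructor
    · rintro ⟨⟨h1, h2, h3⟩, h4, h5⟩
      refine ⟨h2, lt_of_le_of_ne h2.two_le ?_, h1, h4, h5⟩
      rintro rfl
      exact absurd h3 (by decide)
    · rintro ⟨h1, h2, h3, h4, h5⟩
      exact ⟨⟨h3, h1, h1.odd_of_ne_two h2.ne'⟩, h4, h5⟩
  rw [e, card_filter]
  push_cast
  exact sum_congr rfl fun _ _ => by unfold goodInd; congr

theorem sum_curveBox_goodInd (r : ℤ) (h p : ℕ) {A B : ℝ} (hA : 0 ≤ A) (hB : 0 ≤ B) :
    ∑ ab ∈ curveBox A B, goodInd r h p (ab.1 : ZMod p) (ab.2 : ZMod p) =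
      ∑ a ∈ Icc (-(⌊A⌋₊ : ℤ)) ⌊A⌋₊, ∑ b ∈ Icc (-(⌊B⌋₊ : ℤ)) ⌊B⌋₊,
        goodInd r h p (a : ZMod p) (b : ZMod p) := by
  rw [← sum_product', curveBox, Int.natCast_floor_eq_floor hA, Int.natCast_floor_eq_floor hB]
  refine sum_filter_of_ne fun ab _ hne h0 => hne ?_
  unfold goodInd
  rw [if_neg]
  rintro ⟨h1, -⟩
  apply h1
  exact_mod_cast congrArg (Int.cast : ℤ → ZMod p) h0

theorem card_box (M M' : ℕ) : (#((Icc (-(M : ℤ)) M) ×ˢ (Icc (-(M' : ℤ)) M')) : ℝ) =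
    (2 * M + 1) * (2 * M' + 1) := by
  rw [card_product, ← sum_Icc_one, ← sum_Icc_one]
  push_cast
  simp only [sum_const, nsmul_eq_mul, mul_one]

theorem card_curveBox_le {A B : ℝ} (hA : 0 ≤ A) (hB : 0 ≤ B) :
    (#(curveBox A B) : ℝ) ≤ (2 * ⌊A⌋₊ + 1) * (2 * ⌊B⌋₊ + 1) := by
  rw [← card_box, Int.natCast_floor_eq_floor hA, Int.natCast_floor_eq_floor hB]
  exact_mod_cast card_filter_le _ _

theorem le_card_curveBox {A B : ℝ} (hA : 0 ≤ A) (hB : 0 ≤ B) :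
    ((2 * ⌊A⌋₊ + 1) * (2 * ⌊B⌋₊ + 1) : ℝ) ≤ #(curveBox A B) + (2 * ⌊B⌋₊ + 1) := by
  have h1 : (2 * ⌊B⌋₊ + 1 : ℝ) = #(Icc (-⌊B⌋) ⌊B⌋) := by
    rw [← sum_Icc_one, Int.natCast_floor_eq_floor hB]; simp
  rw [← card_box, h1, Int.natCast_floor_eq_floor hA, Int.natCast_floor_eq_floor hB]
  have h2 := card_filter_add_card_filter_not (s := (Icc (-⌊A⌋) ⌊A⌋) ×ˢ (Icc (-⌊B⌋) ⌊B⌋))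
    (fun ab : ℤ × ℤ => 4 * ab.1 ^ 3 + 27 * ab.2 ^ 2 ≠ 0)
  have h3 : #(((Icc (-⌊A⌋) ⌊A⌋) ×ˢ (Icc (-⌊B⌋) ⌊B⌋)).filter
      (fun ab : ℤ × ℤ => ¬ (4 * ab.1 ^ 3 + 27 * ab.2 ^ 2 ≠ 0))) ≤ #(Icc (-⌊B⌋) ⌊B⌋) := by
    refine card_le_card_of_injOn Prod.snd (fun ab hab => ?_) ?_
    · exact (mem_product.1 (mem_filter.1 hab).1).2
    · rintro ⟨a, b⟩ hab ⟨a', b'⟩ hab' (rfl : b = b')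
      have e1 := not_not.1 (mem_filter.1 hab).2
      have e2 := not_not.1 (mem_filter.1 hab').2
      have e3 : a ^ 3 = a' ^ 3 := by dsimp only at e1 e2; linarith
      rw [(Odd.strictMono_pow (by decide : Odd 3)).injective e3]
  rw [curveBox, ← Nat.cast_add, Nat.cast_le]
  exact h2.symm.le.trans (Nat.add_le_add_left h3 _)

end Twist

theorem abs_div_sub_le {F N N' NA NB s E : ℝ} (hNA : 0 < NA) (hNB : 0 < NB) (hN : N = NA * NB)
    (hN' : N' ≤ N) (hNN : N ≤ N' + NB) (hF0 : 0 ≤ F) (hF : F ≤ N')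
    (h : |F - N * s| ≤ N * E) : |1 / N' * F - s| ≤ E + 1 / NA := by
  have hN0 : 0 < N := by rw [hN]; positivity
  have h1 : |F / N - s| ≤ E := by
    have e : F / N - s = (F - N * s) / N := by field_simp
    rw [e, abs_div, abs_of_pos hN0, div_le_iff₀ hN0]
    linarith
  have h2 : |1 / N' * F - F / N| ≤ 1 / NA := by
    rcases (hF0.trans hF).eq_or_lt with h0 | h0
    · have : F = 0 := le_antisymm (h0 ▸ hF) hF0
      rw [this]; simp; exact hNA.le
    · have e : 1 / N' * F - F / N = F / N' * ((N - N') / N) := by field_simp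
      have h3 : (N - N') / N ≤ 1 / NA := by
        rw [div_le_div_iff₀ hN0 hNA, hN]; rw [hN] at hNN; nlinarith
      have h4 : F / N' ≤ 1 := (div_le_one h0).2 hF
      have h5 : 0 ≤ (N - N') / N := div_nonneg (by linarith) hN0.le
      rw [e, abs_of_nonneg (mul_nonneg (by positivity) h5)]
      exact (mul_le_of_le_one_left h5 h4).trans h3
  have e : 1 / N' * F - s = (1 / N' * F - F / N) + (F / N - s) := by ring
  rw [e]
  exact (abs_add_le _ _).trans (by linarith)

theorem exists_curve_average_approx (r : ℤ) (h p : ℕ) [Fact p.Prime] {A B : ℝ} (hA : 1 ≤ A)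
    (hB : 1 ≤ B) :
    ∃ X Y T : ℝ,
      |1 / (#(curveBox A B) : ℝ) *
          (∑ ab ∈ curveBox A B, goodInd r h p (ab.1 : ZMod p) (ab.2 : ZMod p)) -
        (PiFp r h p : ℝ) / ((p : ℝ) * (p - 1))| ≤
        9 / p + 3 / ⌊A⌋₊ + 2 / ⌊B⌋₊ + |X| / ⌊A⌋₊ + |Y| / ⌊B⌋₊ + |T| / (⌊A⌋₊ * ⌊B⌋₊) ∧
      (∀ j : ℕ, 4 * (X ^ 2 / 4) ^ 2 ^ j ≤ lsTerm p (⌊A⌋₊ ^ 2 ^ j) (mulWeight ⌊A⌋₊ j)) ∧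
      (∀ j : ℕ, 6 * (Y ^ 2 / 6) ^ 2 ^ j ≤ lsTerm p (⌊B⌋₊ ^ 2 ^ j) (mulWeight ⌊B⌋₊ j)) ∧
      T ^ 4 ≤ 24 * lsTerm p (⌊A⌋₊ ^ 2 ^ 1) (mulWeight ⌊A⌋₊ 1) *
        lsTerm p (⌊B⌋₊ ^ 2 ^ 1) (mulWeight ⌊B⌋₊ 1) ∧
      T ^ 2 ≤ lsTerm p ⌊A⌋₊ (mulWeight ⌊A⌋₊ 0) * (6 * ⌊B⌋₊) ^ 2 ∧
      T ^ 2 ≤ lsTerm p ⌊B⌋₊ (mulWeight ⌊B⌋₊ 0) * (6 * ⌊A⌋₊) ^ 2 := by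
  obtain ⟨X, Y, T, h1, h2, h3, h4, h5, h6⟩ := exists_box_sum_approx (p := p)
    (fun a b => goodInd r h p a b) (goodInd_nonneg r h) (goodInd_le_one r h)
    (goodInd_twist r h) ⌊A⌋₊ ⌊B⌋₊
  have hA0 : 0 ≤ A := zero_le_one.trans hA
  have hB0 : 0 ≤ B := zero_le_one.trans hB
  have hM : (1 : ℝ) ≤ ⌊A⌋₊ := by exact_mod_cast Nat.floor_pos.2 hA
  have hM' : (1 : ℝ) ≤ ⌊B⌋₊ := by exact_mod_cast Nat.floor_pos.2 hB
  refine ⟨X, Y, T, ?_, h2, h3, h4, h5.trans ?_, h6.trans ?_⟩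
  · have hs := sum_curveBox_goodInd r h p hA0 hB0
    rw [← hs, ← PiFp_eq_sum] at h1
    refine (abs_div_sub_le (by positivity) (by positivity) rfl (card_curveBox_le hA0 hB0)
      (le_card_curveBox hA0 hB0) (sum_nonneg fun _ _ => goodInd_nonneg _ _ _ _) ?_ h1).trans ?_
    · calc _ ≤ ∑ _ab ∈ curveBox A B, (1 : ℝ) := sum_le_sum fun _ _ => goodInd_le_one _ _ _ _
        _ = _ := by simp
    · have e1 : ∀ c : ℝ, 0 ≤ c → c / (2 * (⌊A⌋₊ : ℝ) + 1) ≤ c / ⌊A⌋₊ := fun c hc =>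
        div_le_div_of_nonneg_left hc (by linarith) (by linarith)
      have e2 : ∀ c : ℝ, 0 ≤ c → c / (2 * (⌊B⌋₊ : ℝ) + 1) ≤ c / ⌊B⌋₊ := fun c hc =>
        div_le_div_of_nonneg_left hc (by linarith) (by linarith)
      have e3 : |T| / ((2 * (⌊A⌋₊ : ℝ) + 1) * (2 * (⌊B⌋₊ : ℝ) + 1)) ≤ |T| / (⌊A⌋₊ * ⌊B⌋₊) :=
        div_le_div_of_nonneg_left (abs_nonneg _) (by positivity) (by nlinarith)
      have e4 := e1 2 (by norm_num)
      have e5 := e1 1 (by norm_num)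
      have e6 := e2 2 (by norm_num)
      have e7 := e1 |X| (abs_nonneg _)
      have e8 := e2 |Y| (abs_nonneg _)
      have e9 : (3 : ℝ) / ⌊A⌋₊ = 2 / ⌊A⌋₊ + 1 / ⌊A⌋₊ := by ring
      linarith
  · exact mul_le_mul_of_nonneg_left (pow_le_pow_left₀ (by positivity) (by linarith) 2)
      (lsTerm_nonneg _ _ _)
  · exact mul_le_mul_of_nonneg_left (pow_le_pow_left₀ (by positivity) (by linarith) 2)
      (lsTerm_nonneg _ _ _)

theorem exists_log_pow_le (n : ℕ) {η : ℝ} (hη : 0 < η) :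
    ∃ K : ℝ, 0 < K ∧ ∀ x : ℝ, 1 ≤ x → Real.log x ^ n ≤ K * x ^ η := by
  have hn : (0 : ℝ) < n + 1 := by positivity
  set δ := η / (n + 1) with hδ
  have hδ0 : 0 < δ := by positivity
  refine ⟨(1 / δ) ^ n, by positivity, fun x hx => ?_⟩
  have hx0 : 0 < x := by linarith
  have h1 := Real.log_le_rpow_div hx0.le hδ0
  calc Real.log x ^ n ≤ (x ^ δ / δ) ^ n := pow_le_pow_left₀ (Real.log_nonneg hx) h1 n
    _ = (1 / δ) ^ n * x ^ (δ * n) := by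
        rw [Real.rpow_mul hx0.le, Real.rpow_natCast, ← mul_pow]; congr 1; ring
    _ ≤ (1 / δ) ^ n * x ^ η := by
        refine mul_le_mul_of_nonneg_left (Real.rpow_le_rpow_of_exponent_le hx ?_) (by positivity)
        rw [hδ, div_mul_eq_mul_div, div_le_iff₀ hn]
        nlinarith

theorem sum_le_of_sum_pow_le {s : Finset ℕ} {y : ℕ → ℝ} (hy : ∀ p ∈ s, 0 ≤ y p) {k : ℕ}
    (hk : 0 < k) {x D : ℝ} (hx : 1 ≤ x) (hs : (#s : ℝ) ≤ x) (hD : 0 ≤ D)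
    (h : ∑ p ∈ s, y p ^ (2 * k) ≤ D * x ^ (1 / 2 : ℝ)) :
    ∑ p ∈ s, y p ≤ (D + 1) * x ^ (1 - 1 / (4 * k : ℝ)) := by
  have hx0 : 0 < x := by linarith
  have hk' : (0 : ℝ) < k := by exact_mod_cast hk
  obtain ⟨l, hl⟩ : ∃ l, 2 * k = l + 1 := ⟨2 * k - 1, by omega⟩
  have hl' : 2 * (k : ℝ) = l + 1 := by exact_mod_cast hl
  have h1 : (∑ p ∈ s, y p) ^ (l + 1) ≤ (#s : ℝ) ^ l * ∑ p ∈ s, y p ^ (l + 1) :=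
    pow_sum_le_card_mul_sum_pow hy l
  refine le_of_pow_le_pow_left₀ (n := l + 1) (by omega) (by positivity) ?_
  rw [← hl] at *
  calc (∑ p ∈ s, y p) ^ (2 * k) ≤ (#s : ℝ) ^ l * ∑ p ∈ s, y p ^ (2 * k) := h1
    _ ≤ x ^ l * (D * x ^ (1 / 2 : ℝ)) := by
        gcongr
        exact sum_nonneg fun p hp => pow_nonneg (hy p hp) _
    _ = D * (x ^ (1 - 1 / (4 * k : ℝ))) ^ (2 * k) := by
        rw [← Real.rpow_natCast, ← Real.rpow_natCast, ← Real.rpow_mul hx0.le, mul_left_comm,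
          ← Real.rpow_add hx0]
        congr 2
        push_cast
        field_simp
        linarith
    _ ≤ (D + 1) ^ (2 * k) * (x ^ (1 - 1 / (4 * k : ℝ))) ^ (2 * k) := by
        refine mul_le_mul_of_nonneg_right ?_ (by positivity)
        exact (by linarith : D ≤ D + 1).trans (le_self_pow₀ (by linarith) (by omega))
    _ = _ := (mul_pow _ _ _).symm

theorem exists_sum_amplified_le {m : ℕ} (hm : 0 < m) {ε : ℝ} (hε : 0 < ε) :
    ∃ C η : ℝ, 0 < C ∧ 0 < η ∧ ∀ (x : ℝ) (M : ℕ) (s : Finset ℕ) (X : ℕ → ℝ), 1 ≤ x → 1 ≤ M →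
      x ^ ε / 2 ≤ M → s ⊆ (range (⌊x⌋₊ + 1)).filter Nat.Prime → (#s : ℝ) ≤ x →
      (∀ p ∈ s, ∀ j : ℕ, (m : ℝ) * (X p ^ 2 / m) ^ 2 ^ j ≤ lsTerm p (M ^ 2 ^ j) (mulWeight M j)) →
      ∑ p ∈ s, |X p| / M ≤ C * x ^ (1 - η) := by
  obtain ⟨j, hj⟩ := pow_unbounded_of_one_lt (2 / ε) (one_lt_two : (1 : ℝ) < 2)
  rw [div_lt_iff₀ hε] at hj
  obtain ⟨C, hC, hK⟩ := exists_sum_lsTerm_mulWeight_le j (δ := 1 / 4) (by norm_num)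
  have hm' : (0 : ℝ) < m := by exact_mod_cast hm
  set k : ℕ := 2 ^ j with hk
  have hk0 : 0 < k := by positivity
  have hkR : ((k : ℕ) : ℝ) = 2 ^ j := by rw [hk]; push_cast; rfl
  have hpow : ∀ (j : ℕ) (X : ℝ), (m : ℝ) ^ 2 ^ j * ((m : ℝ) * (X ^ 2 / m) ^ 2 ^ j) =
      m * |X| ^ (2 * 2 ^ j) := by
    intro j X
    rw [pow_mul, sq_abs, div_pow]
    field_simp
  have hm1 : (1 : ℝ) ≤ m := by exact_mod_cast hm
  have hsum : ∀ (j : ℕ) (s : Finset ℕ) (X : ℕ → ℝ) (M : ℕ) (x : ℝ), 1 ≤ M →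
      s ⊆ (range (⌊x⌋₊ + 1)).filter Nat.Prime →
      (∀ p ∈ s, (m : ℝ) * (X p ^ 2 / m) ^ 2 ^ j ≤ lsTerm p (M ^ 2 ^ j) (mulWeight M j)) →
      ∑ p ∈ s, (|X p| / M) ^ (2 * 2 ^ j) ≤ (m : ℝ) ^ 2 ^ j / (M : ℝ) ^ (2 * 2 ^ j) *
        ∑ p ∈ (range (⌊x⌋₊ + 1)).filter Nat.Prime, lsTerm p (M ^ 2 ^ j) (mulWeight M j) := by
    intro j s X M x hM hs hX
    have hM0 : (0 : ℝ) < M := by exact_mod_cast hM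
    refine le_trans ?_ (mul_le_mul_of_nonneg_left (sum_le_sum_of_subset_of_nonneg hs
      fun _ _ _ => lsTerm_nonneg _ _ _) (by positivity))
    rw [mul_sum]
    refine sum_le_sum fun p hp => ?_
    rw [div_pow, div_mul_eq_mul_div]
    refine div_le_div_of_nonneg_right ?_ (by positivity)
    refine le_trans ?_ (mul_le_mul_of_nonneg_left (hX p hp) (by positivity))
    rw [hpow]
    exact le_mul_of_one_le_left (by positivity) hm1
  set D₁ : ℝ := m * 72 with hD₁
  set D₂ : ℝ := (m : ℝ) ^ k * (C * (1 + 2 ^ k)) with hD₂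
  refine ⟨(D₁ + 1) + (D₂ + 1), 1 / (4 * k), by positivity, by positivity,
    fun x M s X hx hM hMx hs hcard hX => ?_⟩
  have hx0 : 0 < x := by linarith
  have hM0 : (0 : ℝ) < M := by exact_mod_cast hM
  have hQ : 0 < ⌊x⌋₊ := Nat.floor_pos.2 hx
  have hQx : ((⌊x⌋₊ : ℕ) : ℝ) ≤ x := Nat.floor_le hx0.le
  have hy : ∀ p ∈ s, 0 ≤ |X p| / M := fun _ _ => by positivity
  have hxp : 0 ≤ x ^ (1 - 1 / (4 * k : ℝ)) := by positivity
  rcases le_total (x ^ 2) M with hbig | hsmall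
  · have h1 : ∑ p ∈ s, (|X p| / M) ^ (2 * 1) ≤ D₁ * x ^ (1 / 2 : ℝ) := by
      have := hsum 0 s X M x hM hs fun p hp => hX p hp 0
      simp only [pow_zero, pow_one] at this
      refine this.trans ?_
      have h2 := sum_lsTerm_mulWeight_zero_le ⌊x⌋₊ M hQ
      calc _ ≤ (m : ℝ) / (M : ℝ) ^ (2 * 1) * (12 * (2 * M + (⌊x⌋₊ : ℝ) ^ 2) * (2 * M)) := by gcongr
        _ ≤ (m : ℝ) / (M : ℝ) ^ (2 * 1) * (12 * (2 * M + M) * (2 * M)) := by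
            gcongr; exact (pow_le_pow_left₀ (by positivity) hQx 2).trans hbig
        _ = D₁ := by rw [hD₁]; field_simp; ring
        _ ≤ D₁ * x ^ (1 / 2 : ℝ) :=
            le_mul_of_one_le_right (by positivity) (Real.one_le_rpow hx (by norm_num))
    refine (sum_le_of_sum_pow_le hy one_pos hx hcard (by positivity) h1).trans ?_
    have h3 : x ^ (1 - 1 / (4 * ((1 : ℕ) : ℝ))) ≤ x ^ (1 - 1 / (4 * k : ℝ)) := by
      refine Real.rpow_le_rpow_of_exponent_le hx ?_
      have : (1 : ℝ) ≤ k := by exact_mod_cast hk0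
      have := one_div_le_one_div_of_le (by norm_num : (0 : ℝ) < 4 * ((1 : ℕ) : ℝ))
        (by push_cast; linarith : 4 * ((1 : ℕ) : ℝ) ≤ 4 * k)
      linarith
    calc _ ≤ (D₁ + 1) * x ^ (1 - 1 / (4 * k : ℝ)) := by gcongr
      _ ≤ _ := mul_le_mul_of_nonneg_right (by linarith [show 0 < D₂ by positivity]) hxp
  · have h1 : ∑ p ∈ s, (|X p| / M) ^ (2 * k) ≤ D₂ * x ^ (1 / 2 : ℝ) := by
      refine (hsum j s X M x hM hs fun p hp => hX p hp j).trans ?_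
      have h2 := hK ⌊x⌋₊ M hQ hM
      have h3 : (⌊x⌋₊ : ℝ) ^ 2 ≤ 2 ^ k * (M : ℝ) ^ k := by
        rw [← mul_pow]
        calc (⌊x⌋₊ : ℝ) ^ 2 ≤ x ^ 2 := pow_le_pow_left₀ (by positivity) hQx 2
          _ = x ^ (2 : ℝ) := (Real.rpow_natCast x 2).symm
          _ ≤ x ^ (ε * k) := Real.rpow_le_rpow_of_exponent_le hx (by rw [hkR]; linarith)
          _ = (x ^ ε) ^ k := by rw [Real.rpow_mul hx0.le, Real.rpow_natCast]
          _ ≤ _ := pow_le_pow_left₀ (by positivity) (by linarith) k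
      have h4 : (M : ℝ) ^ (1 / 4 : ℝ) ≤ x ^ (1 / 2 : ℝ) := by
        calc (M : ℝ) ^ (1 / 4 : ℝ) ≤ (x ^ 2) ^ (1 / 4 : ℝ) :=
              Real.rpow_le_rpow hM0.le hsmall (by norm_num)
          _ = _ := by rw [← Real.rpow_natCast, ← Real.rpow_mul hx0.le]; norm_num
      calc _ ≤ (m : ℝ) ^ k / (M : ℝ) ^ (2 * k) *
            (C * ((M : ℝ) ^ k + (⌊x⌋₊ : ℝ) ^ 2) * ((M : ℝ) ^ k * (M : ℝ) ^ (1 / 4 : ℝ))) := by gcongr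
        _ ≤ (m : ℝ) ^ k / (M : ℝ) ^ (2 * k) *
            (C * ((M : ℝ) ^ k + 2 ^ k * (M : ℝ) ^ k) * ((M : ℝ) ^ k * x ^ (1 / 2 : ℝ))) := by gcongr
        _ = _ := by rw [hD₂, two_mul, pow_add]; field_simp
    refine (sum_le_of_sum_pow_le hy hk0 hx hcard (by positivity) h1).trans ?_
    exact mul_le_mul_of_nonneg_right (by linarith [show 0 < D₁ by positivity]) hxp

theorem exists_rpow_one_sub_le {η : ℝ} (hη : 0 < η) :
    ∃ K : ℝ, 0 < K ∧ ∀ x : ℝ, 3 ≤ x → x ^ (1 - η) ≤ K * (x / Real.log x ^ 2) := by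
  obtain ⟨K, hK, h⟩ := exists_log_pow_le 2 hη
  refine ⟨K, hK, fun x hx => ?_⟩
  have hx0 : 0 < x := by linarith
  have hl : 0 < Real.log x := Real.log_pos (by linarith)
  rw [← mul_div_assoc, le_div_iff₀ (by positivity)]
  calc x ^ (1 - η) * Real.log x ^ 2 ≤ x ^ (1 - η) * (K * x ^ η) := by gcongr; exact h x (by linarith)
    _ = K * (x ^ (1 - η) * x ^ η) := by ring
    _ = K * x := by rw [← Real.rpow_add hx0, sub_add_cancel, Real.rpow_one]

theorem one_le_log_of_three_le {x : ℝ} (hx : 3 ≤ x) : 1 ≤ Real.log x := by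
  rw [Real.le_log_iff_exp_le (by linarith)]
  linarith [Real.exp_one_lt_d9]

theorem sum_le_of_large_side {s : Finset ℕ} {T : ℕ → ℝ} {x : ℝ} {M M' : ℕ} (hx : 1 ≤ x)
    (hM : 1 ≤ M) (hM' : 1 ≤ M') (hs : s ⊆ (range (⌊x⌋₊ + 1)).filter Nat.Prime)
    (hcard : (#s : ℝ) ≤ x) (hbig : x ^ 2 ≤ M)
    (hT : ∀ p ∈ s, T p ^ 2 ≤ lsTerm p M (mulWeight M 0) * (6 * M') ^ 2) :
    ∑ p ∈ s, |T p| / (M * M') ≤ (2592 + 1) * x ^ (1 - 1 / 4 : ℝ) := by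
  have hx0 : 0 < x := by linarith
  have hM0 : (0 : ℝ) < M := by exact_mod_cast hM
  have hM0' : (0 : ℝ) < M' := by exact_mod_cast hM'
  have hQx : ((⌊x⌋₊ : ℕ) : ℝ) ≤ x := Nat.floor_le hx0.le
  have h := sum_le_of_sum_pow_le (s := s) (y := fun p => |T p| / (M * M')) (k := 1) (x := x)
    (D := 2592) (fun _ _ => by positivity) one_pos hx hcard (by norm_num) ?_
  · simpa using h
  · calc ∑ p ∈ s, (|T p| / (M * M')) ^ (2 * 1)
        ≤ ∑ p ∈ s, 36 / (M : ℝ) ^ 2 * lsTerm p M (mulWeight M 0) := by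
          refine sum_le_sum fun p hp => ?_
          rw [mul_one, div_pow, sq_abs, div_le_iff₀ (by positivity)]
          refine (hT p hp).trans_eq ?_
          field_simp; ring
      _ ≤ 36 / (M : ℝ) ^ 2 *
            ∑ p ∈ (range (⌊x⌋₊ + 1)).filter Nat.Prime, lsTerm p M (mulWeight M 0) := by
          rw [← mul_sum]
          exact mul_le_mul_of_nonneg_left (sum_le_sum_of_subset_of_nonneg hs
            fun _ _ _ => lsTerm_nonneg _ _ _) (by positivity)
      _ ≤ 36 / (M : ℝ) ^ 2 * (12 * (2 * M + M) * (2 * M)) := by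
          refine mul_le_mul_of_nonneg_left ((sum_lsTerm_mulWeight_zero_le ⌊x⌋₊ M
            (Nat.floor_pos.2 hx)).trans ?_) (by positivity)
          gcongr
          exact (pow_le_pow_left₀ (by positivity) hQx 2).trans hbig
      _ = 2592 := by field_simp; norm_num
      _ ≤ 2592 * x ^ (1 / 2 : ℝ) :=
          le_mul_of_one_le_right (by norm_num) (Real.one_le_rpow hx (by norm_num))

theorem sum_abs_pow_four_le {s : Finset ℕ} {T f g : ℕ → ℝ} {c x : ℝ} (hf : ∀ p, 0 ≤ f p)
    (hg : ∀ p, 0 ≤ g p) (hc : 0 ≤ c) (hcard : (#s : ℝ) ≤ x)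
    (hT : ∀ p ∈ s, T p ^ 4 ≤ c * f p * g p) :
    (∑ p ∈ s, |T p|) ^ 4 ≤ c * x ^ 2 * ((∑ p ∈ s, f p) * ∑ p ∈ s, g p) := by
  have h1 : ∀ p ∈ s, T p ^ 2 ≤ √(c * f p) * √(g p) := by
    intro p hp
    rw [← Real.sqrt_mul (mul_nonneg hc (hf p))]
    refine Real.le_sqrt_of_sq_le ?_
    rw [← pow_mul]; exact hT p hp
  have h2 : (∑ p ∈ s, T p ^ 2) ^ 2 ≤ c * ((∑ p ∈ s, f p) * ∑ p ∈ s, g p) := by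
    calc (∑ p ∈ s, T p ^ 2) ^ 2 ≤ (∑ p ∈ s, √(c * f p) * √(g p)) ^ 2 :=
          pow_le_pow_left₀ (sum_nonneg fun _ _ => sq_nonneg _) (sum_le_sum h1) 2
      _ ≤ (∑ p ∈ s, √(c * f p) ^ 2) * ∑ p ∈ s, √(g p) ^ 2 := sum_mul_sq_le_sq_mul_sq _ _ _
      _ = (∑ p ∈ s, c * f p) * ∑ p ∈ s, g p := by
          congr 1
          · exact sum_congr rfl fun p _ => Real.sq_sqrt (mul_nonneg hc (hf p))
          · exact sum_congr rfl fun p _ => Real.sq_sqrt (hg p)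
      _ = _ := by rw [← mul_sum, mul_assoc]
  have h3 : (∑ p ∈ s, |T p|) ^ 2 ≤ x * ∑ p ∈ s, T p ^ 2 := by
    have := sq_sum_le_card_mul_sum_sq (s := s) (f := fun p => |T p|)
    simp only [sq_abs] at this
    exact this.trans (mul_le_mul_of_nonneg_right hcard (sum_nonneg fun _ _ => sq_nonneg _))
  calc (∑ p ∈ s, |T p|) ^ 4 = ((∑ p ∈ s, |T p|) ^ 2) ^ 2 := by rw [← pow_mul]
    _ ≤ (x * ∑ p ∈ s, T p ^ 2) ^ 2 := pow_le_pow_left₀ (sq_nonneg _) h3 2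
    _ = x ^ 2 * (∑ p ∈ s, T p ^ 2) ^ 2 := mul_pow _ _ _
    _ ≤ x ^ 2 * (c * ((∑ p ∈ s, f p) * ∑ p ∈ s, g p)) :=
        mul_le_mul_of_nonneg_left h2 (sq_nonneg _)
    _ = _ := by ring

theorem sum_lsTerm_mulWeight_one_le_of_le_sq {s : Finset ℕ} {x : ℝ} {M : ℕ} (hx : 3 ≤ x)
    (hM : 1 ≤ M) (hs : s ⊆ (range (⌊x⌋₊ + 1)).filter Nat.Prime) (hsmall : (M : ℝ) ≤ x ^ 2) :
    ∑ p ∈ s, lsTerm p (M ^ 2 ^ 1) (mulWeight M 1) ≤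
      864 * (2 * (M : ℝ) ^ 2 + x ^ 2) * M ^ 2 * Real.log x ^ 2 := by
  have hx0 : 0 < x := by linarith
  have hM0 : (0 : ℝ) < M := by exact_mod_cast hM
  have hL := one_le_log_of_three_le hx
  have hlog : 1 + Real.log M ≤ 3 * Real.log x := by
    have h1 : Real.log M ≤ Real.log (x ^ 2) := Real.log_le_log hM0 hsmall
    rw [Real.log_pow] at h1
    push_cast at h1
    linarith
  have hlog0 : 0 ≤ Real.log M := Real.log_natCast_nonneg M
  have hQx : ((⌊x⌋₊ : ℕ) : ℝ) ≤ x := Nat.floor_le hx0.le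
  refine (sum_le_sum_of_subset_of_nonneg hs fun _ _ _ => lsTerm_nonneg _ _ _).trans ?_
  refine (sum_lsTerm_mulWeight_one_le ⌊x⌋₊ M (Nat.floor_pos.2 (by linarith))).trans ?_
  calc _ ≤ 12 * (2 * (M : ℝ) ^ 2 + x ^ 2) * (8 * (M * (3 * Real.log x)) ^ 2) := by gcongr
    _ = _ := by ring

theorem exists_sum_bilinear_le {ε : ℝ} (hε : 0 < ε) :
    ∃ C : ℝ, 0 < C ∧ ∀ (x : ℝ) (M M' : ℕ) (s : Finset ℕ) (T : ℕ → ℝ), 3 ≤ x → 1 ≤ M → 1 ≤ M' →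
      x ^ ε / 2 ≤ M → x ^ ε / 2 ≤ M' → x * Real.log x ^ 8 / 4 ≤ M * M' →
      s ⊆ (range (⌊x⌋₊ + 1)).filter Nat.Prime → (#s : ℝ) ≤ x →
      (∀ p ∈ s, T p ^ 4 ≤ 24 * lsTerm p (M ^ 2 ^ 1) (mulWeight M 1) *
        lsTerm p (M' ^ 2 ^ 1) (mulWeight M' 1)) →
      (∀ p ∈ s, T p ^ 2 ≤ lsTerm p M (mulWeight M 0) * (6 * M') ^ 2) →
      (∀ p ∈ s, T p ^ 2 ≤ lsTerm p M' (mulWeight M' 0) * (6 * M) ^ 2) →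
      ∑ p ∈ s, |T p| / (M * M') ≤ C * (x / Real.log x ^ 2) := by
  obtain ⟨K, hK, hK'⟩ := exists_rpow_one_sub_le (η := 1 / 4) (by norm_num)
  obtain ⟨K₁, hK₁, hK₁'⟩ := exists_log_pow_le 12 (η := 2) (by norm_num)
  obtain ⟨K₂, hK₂, hK₂'⟩ := exists_log_pow_le 12 (η := 2 * ε) (by positivity)
  set c : ℝ := 24 * 864 ^ 2 with hc
  set D : ℝ := c * (4 * K₁ + 16 * K₂ + 16) with hD
  refine ⟨(2592 + 1) * K + (D + 1), by positivity,
    fun x M M' s T hx hM hM' hMx hMx' hMM hs hcard h4 hA hB => ?_⟩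
  have hx0 : 0 < x := by linarith
  have hM0 : (0 : ℝ) < M := by exact_mod_cast hM
  have hM0' : (0 : ℝ) < M' := by exact_mod_cast hM'
  have hL := one_le_log_of_three_le hx
  set L := Real.log x with hLdef
  have hL0 : 0 < L := by linarith
  have hD0 : 0 < D := by positivity
  have hxL : 0 < x / L ^ 2 := by positivity
  have hside : (2592 + 1) * x ^ (1 - 1 / 4 : ℝ) ≤
      ((2592 + 1) * K + (D + 1)) * (x / L ^ 2) := by
    have := hK' x hx
    nlinarith
  rcases le_total (x ^ 2) M with hbig | hsmall
  · exact (sum_le_of_large_side (by linarith) hM hM' hs hcard hbig hA).trans hside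
  rcases le_total (x ^ 2) M' with hbig' | hsmall'
  · have := sum_le_of_large_side (by linarith) hM' hM hs hcard hbig' hB
    simp only [mul_comm (M' : ℝ)] at this
    exact this.trans hside
  have e1 := sum_abs_pow_four_le (fun p => lsTerm_nonneg p _ _) (fun p => lsTerm_nonneg p _ _)
    (by norm_num) hcard h4
  have e2 := sum_lsTerm_mulWeight_one_le_of_le_sq hx hM hs hsmall
  have e3 := sum_lsTerm_mulWeight_one_le_of_le_sq hx hM' hs hsmall'
  have e4 : (∑ p ∈ s, |T p| / (M * M')) ^ 4 ≤
      c * x ^ 2 * L ^ 4 * (2 + (x / M) ^ 2) * (2 + (x / M') ^ 2) := by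
    rw [← sum_div, div_pow, div_le_iff₀ (by positivity)]
    calc _ ≤ _ := e1
      _ ≤ 24 * x ^ 2 * ((864 * (2 * (M : ℝ) ^ 2 + x ^ 2) * M ^ 2 * L ^ 2) *
            (864 * (2 * (M' : ℝ) ^ 2 + x ^ 2) * M' ^ 2 * L ^ 2)) := by
          gcongr
          exact sum_nonneg fun _ _ => lsTerm_nonneg _ _ _
      _ = _ := by rw [hc]; field_simp
  have hxε : 0 < x ^ ε := by positivity
  have hdiv : ∀ N : ℕ, 0 < (N : ℝ) → x ^ ε / 2 ≤ N → (x / N) ^ 2 ≤ 4 * (x / x ^ ε) ^ 2 := by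
    intro N hN h
    have : x / N ≤ 2 * (x / x ^ ε) := by
      rw [div_le_iff₀ hN]
      have h2 : x = 2 * (x / x ^ ε) * (x ^ ε / 2) := by field_simp
      calc x = 2 * (x / x ^ ε) * (x ^ ε / 2) := h2
        _ ≤ _ := by gcongr
    calc (x / N) ^ 2 ≤ (2 * (x / x ^ ε)) ^ 2 := by gcongr
      _ = _ := by ring
  have e5 := hdiv M hM0 hMx
  have e6 := hdiv M' hM0' hMx'
  have e7 : (x / M) ^ 2 * (x / M') ^ 2 ≤ 16 * (x / L ^ 8) ^ 2 := by
    have : x / M * (x / M') ≤ 4 * (x / L ^ 8) := by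
      rw [div_mul_div_comm, div_le_iff₀ (by positivity)]
      calc x * x = 4 * (x / L ^ 8) * (x * L ^ 8 / 4) := by field_simp
        _ ≤ _ := by gcongr
    calc (x / M) ^ 2 * (x / M') ^ 2 = (x / M * (x / M')) ^ 2 := (mul_pow _ _ _).symm
      _ ≤ (4 * (x / L ^ 8)) ^ 2 := by gcongr
      _ = _ := by ring
  have e8 : (2 + (x / M) ^ 2) * (2 + (x / M') ^ 2) ≤
      4 + 16 * (x / x ^ ε) ^ 2 + 16 * (x / L ^ 8) ^ 2 := by nlinarith
  have f1 : x ^ 2 * L ^ 4 ≤ K₁ * (x / L ^ 2) ^ 4 := by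
    have := hK₁' x (by linarith)
    rw [show (x : ℝ) ^ (2 : ℝ) = x ^ 2 from Real.rpow_natCast x 2] at this
    rw [div_pow, ← mul_div_assoc, le_div_iff₀ (by positivity)]
    calc x ^ 2 * L ^ 4 * (L ^ 2) ^ 4 = x ^ 2 * L ^ 12 := by ring
      _ ≤ x ^ 2 * (K₁ * x ^ 2) := by gcongr
      _ = _ := by ring
  have f2 : x ^ 2 * L ^ 4 * (x / x ^ ε) ^ 2 ≤ K₂ * (x / L ^ 2) ^ 4 := by
    have := hK₂' x (by linarith)
    rw [mul_comm 2 ε, Real.rpow_mul hx0.le, show (x ^ ε : ℝ) ^ (2 : ℝ) = (x ^ ε) ^ 2 from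
      Real.rpow_natCast _ 2] at this
    rw [div_pow x (L ^ 2), ← mul_div_assoc, le_div_iff₀ (by positivity)]
    calc x ^ 2 * L ^ 4 * (x / x ^ ε) ^ 2 * (L ^ 2) ^ 4 = x ^ 4 / (x ^ ε) ^ 2 * L ^ 12 := by
          field_simp
      _ ≤ x ^ 4 / (x ^ ε) ^ 2 * (K₂ * (x ^ ε) ^ 2) := by gcongr
      _ = _ := by field_simp
  have f3 : x ^ 2 * L ^ 4 * (x / L ^ 8) ^ 2 ≤ (x / L ^ 2) ^ 4 := by
    rw [div_pow x (L ^ 2), le_div_iff₀ (by positivity)]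
    have : x ^ 2 * L ^ 4 * (x / L ^ 8) ^ 2 * (L ^ 2) ^ 4 = x ^ 4 / L ^ 4 := by field_simp
    rw [this]
    exact div_le_self (by positivity) (one_le_pow₀ hL)
  have e9 : (∑ p ∈ s, |T p| / (M * M')) ^ 4 ≤ ((D + 1) * (x / L ^ 2)) ^ 4 := by
    calc _ ≤ _ := e4
      _ = c * x ^ 2 * L ^ 4 * ((2 + (x / M) ^ 2) * (2 + (x / M') ^ 2)) := by ring
      _ ≤ c * x ^ 2 * L ^ 4 * (4 + 16 * (x / x ^ ε) ^ 2 + 16 * (x / L ^ 8) ^ 2) := by gcongr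
      _ = c * (4 * (x ^ 2 * L ^ 4) + 16 * (x ^ 2 * L ^ 4 * (x / x ^ ε) ^ 2) +
            16 * (x ^ 2 * L ^ 4 * (x / L ^ 8) ^ 2)) := by ring
      _ ≤ c * (4 * (K₁ * (x / L ^ 2) ^ 4) + 16 * (K₂ * (x / L ^ 2) ^ 4) +
            16 * (x / L ^ 2) ^ 4) := by gcongr
      _ = D * (x / L ^ 2) ^ 4 := by rw [hD]; ring
      _ ≤ (D + 1) ^ 4 * (x / L ^ 2) ^ 4 := by
          gcongr
          exact (by linarith : D ≤ D + 1).trans (le_self_pow₀ (by linarith) (by norm_num))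
      _ = _ := (mul_pow _ _ _).symm
  refine (le_of_pow_le_pow_left₀ (by norm_num) (by positivity) e9).trans ?_
  exact mul_le_mul_of_nonneg_right (by linarith [mul_pos (show (0 : ℝ) < 2592 + 1 by norm_num) hK]) hxL.le

theorem sum_inv_le {s : Finset ℕ} {x : ℝ} (hx : 1 ≤ x) (hs : s ⊆ Icc 1 ⌊x⌋₊) :
    ∑ p ∈ s, ((p : ℝ))⁻¹ ≤ 1 + Real.log x := by
  have h1 := harmonic_le_one_add_log ⌊x⌋₊
  rw [harmonic_eq_sum_Icc] at h1
  push_cast at h1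
  refine (sum_le_sum_of_subset_of_nonneg hs fun _ _ _ => by positivity).trans (h1.trans ?_)
  gcongr
  · exact_mod_cast Nat.floor_pos.2 hx
  · exact Nat.floor_le (by linarith)

theorem half_le_floor {A : ℝ} (hA : 1 ≤ A) : A / 2 ≤ ⌊A⌋₊ := by
  have h1 := Nat.lt_floor_add_one A
  have h2 : (1 : ℝ) ≤ ⌊A⌋₊ := by exact_mod_cast Nat.floor_pos.2 hA
  linarith

theorem div_le_of_rpow_half_le {x ε M : ℝ} (hx : 0 < x) (hM : x ^ ε / 2 ≤ M) :
    x / M ≤ 2 * x ^ (1 - ε) := by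
  have h0 : 0 < x ^ ε := by positivity
  rw [Real.rpow_sub hx, Real.rpow_one, div_le_iff₀ (by linarith)]
  calc x = 2 * (x / x ^ ε) * (x ^ ε / 2) := by field_simp
    _ ≤ _ := by gcongr

/-- the average of `Π^𝔟_{E,r,h}(x)` over `𝒞(A,B)` equals
`Σ_{p ≤ x odd prime} Π^𝔟(p)/(p(p-1)) + O(x/(log x)²)` for `A, B ≥ x^ε` and
`AB ≥ x (log x)^8`. -/
theorem stmt2 (h : ℕ) (hpos : 0 < h) (hodd : Odd h) (r : ℤ) (ε : ℝ) (hε : 0 < ε) :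
    ∃ C : ℝ, ∀ x A B : ℝ, 3 ≤ x → x ^ ε ≤ A → x ^ ε ≤ B →
      x * (Real.log x) ^ 8 ≤ A * B →
      |(1 / ((curveBox A B).card : ℝ)) *
          (∑ ab ∈ curveBox A B, (PiQb r h ab.1 ab.2 x : ℝ)) -
          ∑ p ∈ (Finset.range (⌊x⌋₊ + 1)).filter (fun p => p.Prime ∧ Odd p),
            (PiFp r h p : ℝ) / ((p : ℝ) * ((p : ℝ) - 1))| ≤
        C * x / (Real.log x) ^ 2 := by
  obtain ⟨C₁, η₁, hC₁, hη₁, hX⟩ := exists_sum_amplified_le (m := 4) (by norm_num) hε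
  obtain ⟨C₂, η₂, hC₂, hη₂, hY⟩ := exists_sum_amplified_le (m := 6) (by norm_num) hε
  obtain ⟨C₃, hC₃, hT⟩ := exists_sum_bilinear_le hε
  obtain ⟨K₀, hK₀, hlog⟩ := exists_log_pow_le 3 (η := 1) one_pos
  obtain ⟨K, hK, hKε⟩ := exists_rpow_one_sub_le hε
  obtain ⟨K₁, hK₁, hKη₁⟩ := exists_rpow_one_sub_le hη₁
  obtain ⟨K₂, hK₂, hKη₂⟩ := exists_rpow_one_sub_le hη₂
  refine ⟨18 * K₀ + 10 * K + C₁ * K₁ + C₂ * K₂ + C₃, fun x A B hx hA hB hAB => ?_⟩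
  have hx0 : 0 < x := by linarith
  have hx1 : 1 ≤ x := by linarith
  have hL := one_le_log_of_three_le hx
  have hxε : 1 ≤ x ^ ε := Real.one_le_rpow hx1 hε.le
  have hA1 := hxε.trans hA
  have hB1 := hxε.trans hB
  set s : Finset ℕ := (range (⌊x⌋₊ + 1)).filter (fun p => p.Prime ∧ Odd p) with hs
  have hprime : ∀ p ∈ s, p.Prime := fun p hp => (mem_filter.1 hp).2.1
  have hsub : s ⊆ (range (⌊x⌋₊ + 1)).filter Nat.Prime :=
    monotone_filter_right _ fun p _ hp => hp.1
  have hIcc : s ⊆ Icc 1 ⌊x⌋₊ := fun p hp => mem_Icc.2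
    ⟨(hprime p hp).one_le, Nat.lt_succ_iff.1 (mem_range.1 (mem_filter.1 hp).1)⟩
  have hcard : (#s : ℝ) ≤ x := by
    have h1 := card_le_card hIcc
    rw [Nat.card_Icc, Nat.add_sub_cancel] at h1
    exact (Nat.cast_le.2 h1).trans (Nat.floor_le hx0.le)
  have key := fun p (hp : p ∈ s) =>
    have : Fact p.Prime := ⟨hprime p hp⟩
    exists_curve_average_approx r h p hA1 hB1
  choose! X Y T hXYT using key
  have hM1 : 1 ≤ ⌊A⌋₊ := Nat.floor_pos.2 hA1
  have hM1' : 1 ≤ ⌊B⌋₊ := Nat.floor_pos.2 hB1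
  have hAM := half_le_floor hA1
  have hBM := half_le_floor hB1
  have hMx : x ^ ε / 2 ≤ ⌊A⌋₊ := by linarith
  have hMx' : x ^ ε / 2 ≤ ⌊B⌋₊ := by linarith
  have hMM : x * Real.log x ^ 8 / 4 ≤ ⌊A⌋₊ * ⌊B⌋₊ := by
    calc x * Real.log x ^ 8 / 4 ≤ A * B / 4 := by gcongr
      _ = A / 2 * (B / 2) := by ring
      _ ≤ _ := by gcongr
  have bX := (hX x ⌊A⌋₊ s X hx1 hM1 hMx hsub hcard
    fun p hp j => by exact_mod_cast (hXYT p hp).2.1 j)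
  have bY := (hY x ⌊B⌋₊ s Y hx1 hM1' hMx' hsub hcard
    fun p hp j => by exact_mod_cast (hXYT p hp).2.2.1 j)
  have bT := hT x ⌊A⌋₊ ⌊B⌋₊ s T hx hM1 hM1' hMx hMx' hMM hsub hcard
    (fun p hp => (hXYT p hp).2.2.2.1) (fun p hp => (hXYT p hp).2.2.2.2.1)
    (fun p hp => (hXYT p hp).2.2.2.2.2)
  have hconst : ∀ {N : ℕ}, x ^ ε / 2 ≤ N → #s * (1 / (N : ℝ)) ≤ 2 * (K * (x / Real.log x ^ 2)) := by
    intro N hN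
    calc (#s : ℝ) * (1 / (N : ℝ)) ≤ x * (1 / (N : ℝ)) := by gcongr
      _ = x / N := by ring
      _ ≤ 2 * x ^ (1 - ε) := div_le_of_rpow_half_le hx0 hN
      _ ≤ _ := by gcongr; exact hKε x hx
  have bA := hconst hMx
  have bB := hconst hMx'
  have bp : ∑ p ∈ s, ((p : ℝ))⁻¹ ≤ 2 * (K₀ * (x / Real.log x ^ 2)) := by
    have h1 := hlog x hx1
    rw [Real.rpow_one] at h1
    have h2 : Real.log x ≤ K₀ * (x / Real.log x ^ 2) := by
      rw [← mul_div_assoc, le_div_iff₀ (by positivity)]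
      calc _ = Real.log x ^ 3 := by ring
        _ ≤ _ := h1
    linarith [sum_inv_le hx1 hIcc]
  have hswap : (1 / (#(curveBox A B) : ℝ)) * (∑ ab ∈ curveBox A B, (PiQb r h ab.1 ab.2 x : ℝ)) =
      ∑ p ∈ s, 1 / (#(curveBox A B) : ℝ) *
        ∑ ab ∈ curveBox A B, goodInd r h p (ab.1 : ZMod p) (ab.2 : ZMod p) := by
    rw [← mul_sum, sum_comm]
    exact congrArg _ (sum_congr rfl fun ab _ => PiQb_eq_sum r h ab.1 ab.2 hx0.le)
  rw [hswap, ← sum_sub_distrib]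
  calc _ ≤ ∑ p ∈ s, (9 / (p : ℝ) + 3 / ⌊A⌋₊ + 2 / ⌊B⌋₊ + |X p| / ⌊A⌋₊ + |Y p| / ⌊B⌋₊ +
        |T p| / (⌊A⌋₊ * ⌊B⌋₊)) :=
        (abs_sum_le_sum_abs _ _).trans (sum_le_sum fun p hp => (hXYT p hp).1)
    _ = 9 * ∑ p ∈ s, ((p : ℝ))⁻¹ + 3 * (#s * (1 / (⌊A⌋₊ : ℝ))) + 2 * (#s * (1 / (⌊B⌋₊ : ℝ))) +
        ∑ p ∈ s, |X p| / ⌊A⌋₊ + ∑ p ∈ s, |Y p| / ⌊B⌋₊ + ∑ p ∈ s, |T p| / (⌊A⌋₊ * ⌊B⌋₊) := by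
      simp only [sum_add_distrib, sum_const, nsmul_eq_mul, mul_sum, div_eq_mul_inv]
      ring
    _ ≤ 9 * (2 * (K₀ * (x / Real.log x ^ 2))) + 3 * (2 * (K * (x / Real.log x ^ 2))) +
        2 * (2 * (K * (x / Real.log x ^ 2))) + C₁ * (K₁ * (x / Real.log x ^ 2)) +
        C₂ * (K₂ * (x / Real.log x ^ 2)) + C₃ * (x / Real.log x ^ 2) := by
      gcongr
      · exact bX.trans (by gcongr; exact hKη₁ x hx)
      · exact bY.trans (by gcongr; exact hKη₂ x hx)
    _ = _ := by ring
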